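/- If N ≥ 5, then there exist δ > 0 and C > 0 such that ‖N(ω_1,ω_2)‖_{**} ≤ C‖(ω_1,ω_2)‖_*^{1+δ} for all pairs (ω_1,ω_2) ∈ X satisfying |ω_1| ≤ ½PU_{x,μ} and |ω_2| ≤ ½PV_{x,μ} pointwise. -/

import Mathlib

open Real MeasureTheory Filter Topology
open scoped Classical

noncomputable section

namespace PeriodicCriticalSystem

/-- Euclidean space `ℝ^N`. -/
abbrev Euc (N : ℕ) : Type := EuclideanSpace ℝ (Fin N)

/-- The `i`-th standard coordinate vector `e_i`. -/
def e (N : ℕ) (i : Fin N) : Euc N := EuclideanSpace.single i 1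

/-- The strip `Ω = {y : |y_i| ≤ L/2, i = 1,…,k}`. -/
def strip (N k : ℕ) (L : ℝ) : Set (Euc N) :=
  {y : Euc N | ∀ i : Fin N, (i : ℕ) < k → |y i| ≤ L / 2}

/-- The `i`-th partial derivative. -/
def pd {N : ℕ} (i : Fin N) (u : Euc N → ℝ) (y : Euc N) : ℝ := fderiv ℝ u y (e N i)

/-- The Laplacian `Δu = Σ_i ∂²u/∂y_i²`. -/
def lap {N : ℕ} (u : Euc N → ℝ) (y : Euc N) : ℝ :=
  ∑ i : Fin N, iteratedDeriv 2 (fun t : ℝ => u (y + t • e N i)) 0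

/-- The norm `|y''|` of the last `N - k` coordinates. -/
def tailNorm {N : ℕ} (k : ℕ) (y : Euc N) : ℝ :=
  Real.sqrt (∑ i : Fin N, if k ≤ (i : ℕ) then (y i) ^ 2 else 0)

/-- The periodic boundary conditions on the strip, together with decay as `|y''| → ∞`. -/
structure PeriodicBC (N k : ℕ) (L : ℝ) (u : Euc N → ℝ) : Prop where
  per : ∀ i : Fin N, (i : ℕ) < k → ∀ y : Euc N, y i = -(L / 2) → u (y + L • e N i) = u y
  per_deriv : ∀ i : Fin N, (i : ℕ) < k → ∀ y : Euc N, y i = -(L / 2) →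
    pd i u (y + L • e N i) = pd i u y
  decay : ∀ ε : ℝ, 0 < ε → ∃ R : ℝ, ∀ y ∈ strip N k L, R ≤ tailNorm k y → |u y| < ε

/-- The critical Sobolev exponent `2* = 2N/(N-2)`. -/
def tS (N : ℕ) : ℝ := 2 * (N : ℝ) / ((N : ℝ) - 2)

/-- Conditions (A₁) and (A₂) on a coefficient function `K`. -/
structure CondA (N k : ℕ) (K : Euc N → ℝ) (a β : Fin N → ℝ) (βm βM σ : ℝ) : Prop where
  periodic : ∀ i : Fin N, (i : ℕ) < k → ∀ y : Euc N, K (y + e N i) = K y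
  bounded : ∃ M : ℝ, ∀ y : Euc N, |K y| ≤ M
  a_ne : ∀ i : Fin N, a i ≠ 0
  β_gt : ∀ i : Fin N, (N : ℝ) - 2 < β i
  β_lt : ∀ i : Fin N, β i < (N : ℝ)
  βm_le : ∀ i : Fin N, βm ≤ β i
  βm_mem : ∃ i : Fin N, β i = βm
  le_βM : ∀ i : Fin N, β i ≤ βM
  βM_mem : ∃ i : Fin N, β i = βM
  βM_le : βM ≤ βm * (1 + 1 / ((N : ℝ) - 2))
  σ_pos : 0 < σ
  expansion : ∃ δ C : ℝ, 0 < δ ∧ 0 < C ∧ ∀ x : Euc N, ‖x‖ < δ →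
    |K x - 1 - ∑ i : Fin N, a i * |x i| ^ (β i)| ≤ C * ‖x‖ ^ (βM + σ)
  neg_sum : (∑ i ∈ Finset.univ.filter (fun i => β i = βm), a i) < 0

/-- The standard bubble `W_{x,μ}`. -/
def Wb (N : ℕ) (x : Euc N) (μ : ℝ) (y : Euc N) : ℝ :=
  ((N : ℝ) * ((N : ℝ) - 2)) ^ (((N : ℝ) - 2) / 4) * μ ^ (((N : ℝ) - 2) / 2) /
    (1 + μ ^ 2 * ‖y - x‖ ^ 2) ^ (((N : ℝ) - 2) / 2)

/-- The synchronized bubble `U_{x,μ} = s W_{x,μ}`. -/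
def Ub (N : ℕ) (s : ℝ) (x : Euc N) (μ : ℝ) (y : Euc N) : ℝ := s * Wb N x μ y

/-- The synchronized bubble `V_{x,μ} = κ s W_{x,μ}`. -/
def Vb (N : ℕ) (s κ : ℝ) (x : Euc N) (μ : ℝ) (y : Euc N) : ℝ := κ * s * Wb N x μ y

/-- The algebraic relations defining the synchronization constants `s` and `κ`. -/
def SyncConst (N : ℕ) (s κ : ℝ) : Prop :=
  0 < s ∧ 0 < κ ∧ s ^ (tS N - 2) = 2 / (2 + κ ^ (tS N / 2)) ∧
    2 + κ ^ (tS N / 2) - κ ^ (tS N / 2 - 1) - 2 * κ ^ (tS N - 1) = 0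

/-- The lattice `Q_k` of integer points in the first `k` coordinates. -/
def Qlat (N k : ℕ) : Set (Euc N) :=
  {y : Euc N | (∀ i : Fin N, ∃ m : ℤ, y i = (m : ℝ)) ∧ ∀ i : Fin N, k ≤ (i : ℕ) → y i = 0}

/-- `P` enumerates the lattice `Q_k` with `P 0 = 0`. -/
def LatticeEnum (N k : ℕ) (P : ℕ → Euc N) : Prop :=
  Function.Injective P ∧ Set.range P = Qlat N k ∧ P 0 = 0

/-- The area `ω_{N-1}` of the unit sphere `S^{N-1}`. -/
def sphereArea (N : ℕ) : ℝ := (N : ℝ) * (volume (Metric.ball (0 : Euc N) 1)).toReal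

/-- The fundamental solution `Γ(y,z)` of `-Δ`. -/
def Γfun (N : ℕ) (y z : Euc N) : ℝ :=
  1 / (((N : ℝ) - 2) * sphereArea N * ‖y - z‖ ^ ((N : ℝ) - 2))

/-- The Green's function of `-Δ` on the strip with periodic boundary conditions. -/
def Green (N : ℕ) (L : ℝ) (P : ℕ → Euc N) (y z : Euc N) : ℝ :=
  ∑' j : ℕ, Γfun N (y + L • P j) z

/-- The projected bubble `PU_{x,μ}`. -/
def PU (N k : ℕ) (L : ℝ) (P : ℕ → Euc N) (s κ : ℝ) (x : Euc N) (μ : ℝ) (y : Euc N) : ℝ :=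
  ∫ z in strip N k L, Green N L P y z *
    (Ub N s x μ z ^ (tS N - 1) +
      (1 / 2) * Ub N s x μ z ^ (tS N / 2 - 1) * Vb N s κ x μ z ^ (tS N / 2))

/-- The projected bubble `PV_{x,μ}`. -/
def PV (N k : ℕ) (L : ℝ) (P : ℕ → Euc N) (s κ : ℝ) (x : Euc N) (μ : ℝ) (y : Euc N) : ℝ :=
  ∫ z in strip N k L, Green N L P y z *
    (Vb N s κ x μ z ^ (tS N - 1) +
      (1 / 2) * Vb N s κ x μ z ^ (tS N / 2 - 1) * Ub N s x μ z ^ (tS N / 2))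

/-- The translated centers `x_j = x - L P_j`. -/
def xc {N : ℕ} (L : ℝ) (P : ℕ → Euc N) (x : Euc N) (j : ℕ) : Euc N := x - L • P j

/-- The extra weight `σ(y)`. -/
def σw {N : ℕ} (x : Euc N) (μ τ : ℝ) (y : Euc N) : ℝ :=
  min 1 (((1 + μ * ‖y - x‖) / μ) ^ (τ - 1))

/-- The weight defining the `*` norm. -/
def wStar (N : ℕ) (L : ℝ) (P : ℕ → Euc N) (x : Euc N) (μ τ : ℝ) (y : Euc N) : ℝ :=
  σw x μ τ y *
    ∑' j : ℕ, μ ^ (((N : ℝ) - 2) / 2) / (1 + μ * ‖y - xc L P x j‖) ^ (((N : ℝ) - 2) / 2 + τ)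

/-- The weight defining the `**` norm. -/
def wStarStar (N : ℕ) (L : ℝ) (P : ℕ → Euc N) (x : Euc N) (μ τ : ℝ) (y : Euc N) : ℝ :=
  σw x μ τ y *
    ∑' j : ℕ, μ ^ (((N : ℝ) + 2) / 2) / (1 + μ * ‖y - xc L P x j‖) ^ (((N : ℝ) + 2) / 2 + τ)

/-- The `*` norm. -/
def normStar (N k : ℕ) (L : ℝ) (P : ℕ → Euc N) (x : Euc N) (μ τ : ℝ) (u : Euc N → ℝ) : ℝ :=
  sSup ((fun y => |u y| / wStar N L P x μ τ y) '' strip N k L)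

/-- The `**` norm. -/
def normStarStar (N k : ℕ) (L : ℝ) (P : ℕ → Euc N) (x : Euc N) (μ τ : ℝ) (f : Euc N → ℝ) : ℝ :=
  sSup ((fun y => |f y| / wStarStar N L P x μ τ y) '' strip N k L)

/-- Finiteness of the `*` norm. -/
def FiniteStar (N k : ℕ) (L : ℝ) (P : ℕ → Euc N) (x : Euc N) (μ τ : ℝ) (u : Euc N → ℝ) : Prop :=
  BddAbove ((fun y => |u y| / wStar N L P x μ τ y) '' strip N k L)

/-- Finiteness of the `**` norm. -/
def FiniteStarStar (N k : ℕ) (L : ℝ) (P : ℕ → Euc N) (x : Euc N) (μ τ : ℝ)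
    (f : Euc N → ℝ) : Prop :=
  BddAbove ((fun y => |f y| / wStarStar N L P x μ τ y) '' strip N k L)

/-- Membership of a pair in the space `X`. -/
def MemX (N k : ℕ) (L : ℝ) (P : ℕ → Euc N) (x : Euc N) (μ τ : ℝ) (u v : Euc N → ℝ) : Prop :=
  PeriodicBC N k L u ∧ PeriodicBC N k L v ∧
    FiniteStar N k L P x μ τ u ∧ FiniteStar N k L P x μ τ v

/-- Membership of a pair in the space `Y`. -/
def MemY (N k : ℕ) (L : ℝ) (P : ℕ → Euc N) (x : Euc N) (μ τ : ℝ) (f g : Euc N → ℝ) : Prop :=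
  FiniteStarStar N k L P x μ τ f ∧ FiniteStarStar N k L P x μ τ g

/-- The operator `(-Δ)^{-1}` given by the Green's function. -/
def invLap (N k : ℕ) (L : ℝ) (P : ℕ → Euc N) (f : Euc N → ℝ) (y : Euc N) : ℝ :=
  ∫ z in strip N k L, Green N L P z y * f z

/-- `Y_h`: derivatives of `U_{x,μ}` in `x_h` (`h < N`) and in `μ` (`h = N+1`). -/
def Yd (N : ℕ) (s : ℝ) (x : Euc N) (μ : ℝ) (h : Fin (N + 1)) (y : Euc N) : ℝ :=
  if hh : (h : ℕ) < N then fderiv ℝ (fun x' => Ub N s x' μ y) x (e N ⟨(h : ℕ), hh⟩)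
  else deriv (fun μ' => Ub N s x μ' y) μ

/-- `Z_h`: derivatives of `V_{x,μ}`. -/
def Zd (N : ℕ) (s κ : ℝ) (x : Euc N) (μ : ℝ) (h : Fin (N + 1)) (y : Euc N) : ℝ :=
  if hh : (h : ℕ) < N then fderiv ℝ (fun x' => Vb N s κ x' μ y) x (e N ⟨(h : ℕ), hh⟩)
  else deriv (fun μ' => Vb N s κ x μ' y) μ

/-- `∂_h PU_{x,μ}`. -/
def dPU (N k : ℕ) (L : ℝ) (P : ℕ → Euc N) (s κ : ℝ) (x : Euc N) (μ : ℝ) (h : Fin (N + 1))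
    (y : Euc N) : ℝ :=
  if hh : (h : ℕ) < N then fderiv ℝ (fun x' => PU N k L P s κ x' μ y) x (e N ⟨(h : ℕ), hh⟩)
  else deriv (fun μ' => PU N k L P s κ x μ' y) μ

/-- `∂_h PV_{x,μ}`. -/
def dPV (N k : ℕ) (L : ℝ) (P : ℕ → Euc N) (s κ : ℝ) (x : Euc N) (μ : ℝ) (h : Fin (N + 1))
    (y : Euc N) : ℝ :=
  if hh : (h : ℕ) < N then fderiv ℝ (fun x' => PV N k L P s κ x' μ y) x (e N ⟨(h : ℕ), hh⟩)
  else deriv (fun μ' => PV N k L P s κ x μ' y) μ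

/-- `α(h) = 1` for `h = 1,…,N` and `α(N+1) = -1`. -/
def αe (N : ℕ) (h : Fin (N + 1)) : ℝ := if (h : ℕ) < N then 1 else -1

/-- Membership of a pair in the space `E`. -/
def MemE (N k : ℕ) (L : ℝ) (P : ℕ → Euc N) (s κ : ℝ) (x : Euc N) (μ τ : ℝ)
    (u v : Euc N → ℝ) : Prop :=
  MemX N k L P x μ τ u v ∧
    (∀ h : Fin (N + 1),
      (∫ y in strip N k L, u y * Ub N s x μ y ^ (tS N - 2) * Yd N s x μ h y) = 0) ∧
    (∀ h : Fin (N + 1),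
      (∫ y in strip N k L, v y * Vb N s κ x μ y ^ (tS N - 2) * Zd N s κ x μ h y) = 0)

/-- Membership of a pair in the space `F`. -/
def MemF (N k : ℕ) (L : ℝ) (P : ℕ → Euc N) (s κ : ℝ) (x : Euc N) (μ : ℝ)
    (f g : Euc N → ℝ) : Prop :=
  (∀ h : Fin (N + 1), (∫ y in strip N k L, f y * dPU N k L P s κ x μ h y) = 0) ∧
  (∀ h : Fin (N + 1), (∫ y in strip N k L, g y * dPV N k L P s κ x μ h y) = 0)

/-- The admissible range of the parameters `(x, μ)` relative to `L`. -/
def Admissible (N : ℕ) (θ C0 β : ℝ) (L : ℝ) (x : Euc N) (μ : ℝ) : Prop :=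
  1 ≤ μ ∧ 1 ≤ L ∧ ‖x‖ ≤ μ ^ (-(1 + θ)) ∧
    μ * L ^ (-(((N : ℝ) - 2) / (β - ((N : ℝ) - 2)))) ∈ Set.Icc (C0 / 2) (2 * C0)

/-- First component of the linearized operator. -/
def lin1 (N k : ℕ) (L : ℝ) (P : ℕ → Euc N) (s κ : ℝ) (K1 : Euc N → ℝ) (x : Euc N) (μ : ℝ)
    (ω1 ω2 : Euc N → ℝ) (y : Euc N) : ℝ :=
  K1 y * PU N k L P s κ x μ y ^ (tS N - 2) * ω1 y -
    (1 / ((N : ℝ) + 2)) * PU N k L P s κ x μ y ^ ((4 - (N : ℝ)) / ((N : ℝ) - 2)) *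
      PV N k L P s κ x μ y ^ ((N : ℝ) / ((N : ℝ) - 2)) * ω1 y -
    ((N : ℝ) / (2 * ((N : ℝ) + 2))) * PU N k L P s κ x μ y ^ (2 / ((N : ℝ) - 2)) *
      PV N k L P s κ x μ y ^ (2 / ((N : ℝ) - 2)) * ω2 y

/-- Second component of the linearized operator. -/
def lin2 (N k : ℕ) (L : ℝ) (P : ℕ → Euc N) (s κ : ℝ) (K2 : Euc N → ℝ) (x : Euc N) (μ : ℝ)
    (ω1 ω2 : Euc N → ℝ) (y : Euc N) : ℝ :=
  K2 y * PV N k L P s κ x μ y ^ (tS N - 2) * ω2 y -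
    (1 / ((N : ℝ) + 2)) * PV N k L P s κ x μ y ^ ((4 - (N : ℝ)) / ((N : ℝ) - 2)) *
      PU N k L P s κ x μ y ^ ((N : ℝ) / ((N : ℝ) - 2)) * ω2 y -
    ((N : ℝ) / (2 * ((N : ℝ) + 2))) * PV N k L P s κ x μ y ^ (2 / ((N : ℝ) - 2)) *
      PU N k L P s κ x μ y ^ (2 / ((N : ℝ) - 2)) * ω1 y

/-- First component `ℓ₁` of the error term. -/
def ell1 (N k : ℕ) (L : ℝ) (P : ℕ → Euc N) (s κ : ℝ) (K1 : Euc N → ℝ) (x : Euc N) (μ : ℝ)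
    (y : Euc N) : ℝ :=
  K1 y * PU N k L P s κ x μ y ^ (tS N - 1) - Ub N s x μ y ^ (tS N - 1) -
    (1 / 2) * (Ub N s x μ y ^ (tS N / 2 - 1) * Vb N s κ x μ y ^ (tS N / 2) -
      PU N k L P s κ x μ y ^ (tS N / 2 - 1) * PV N k L P s κ x μ y ^ (tS N / 2))

/-- Second component `ℓ₂` of the error term. -/
def ell2 (N k : ℕ) (L : ℝ) (P : ℕ → Euc N) (s κ : ℝ) (K2 : Euc N → ℝ) (x : Euc N) (μ : ℝ)
    (y : Euc N) : ℝ :=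
  K2 y * PV N k L P s κ x μ y ^ (tS N - 1) - Vb N s κ x μ y ^ (tS N - 1) -
    (1 / 2) * (Vb N s κ x μ y ^ (tS N / 2 - 1) * Ub N s x μ y ^ (tS N / 2) -
      PV N k L P s κ x μ y ^ (tS N / 2 - 1) * PU N k L P s κ x μ y ^ (tS N / 2))

/-- First component `N₁` of the higher order term. -/
def Nl1 (N k : ℕ) (L : ℝ) (P : ℕ → Euc N) (s κ : ℝ) (K1 : Euc N → ℝ) (x : Euc N) (μ : ℝ)
    (ω1 ω2 : Euc N → ℝ) (y : Euc N) : ℝ :=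
  K1 y * ((max (PU N k L P s κ x μ y + ω1 y) 0) ^ (tS N - 1) -
      PU N k L P s κ x μ y ^ (tS N - 1) -
      (tS N - 1) * PU N k L P s κ x μ y ^ (tS N - 2) * ω1 y) +
    (1 / 2) * ((PU N k L P s κ x μ y + ω1 y) ^ (2 / ((N : ℝ) - 2)) *
        (PV N k L P s κ x μ y + ω2 y) ^ ((N : ℝ) / ((N : ℝ) - 2)) -
      PU N k L P s κ x μ y ^ (2 / ((N : ℝ) - 2)) *
        PV N k L P s κ x μ y ^ ((N : ℝ) / ((N : ℝ) - 2))) -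
    (1 / ((N : ℝ) - 2)) * PU N k L P s κ x μ y ^ ((4 - (N : ℝ)) / ((N : ℝ) - 2)) *
      PV N k L P s κ x μ y ^ ((N : ℝ) / ((N : ℝ) - 2)) * ω1 y -
    ((N : ℝ) / (2 * ((N : ℝ) - 2))) * PU N k L P s κ x μ y ^ (2 / ((N : ℝ) - 2)) *
      PV N k L P s κ x μ y ^ (2 / ((N : ℝ) - 2)) * ω2 y

/-- Second component `N₂` of the higher order term. -/
def Nl2 (N k : ℕ) (L : ℝ) (P : ℕ → Euc N) (s κ : ℝ) (K2 : Euc N → ℝ) (x : Euc N) (μ : ℝ)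
    (ω1 ω2 : Euc N → ℝ) (y : Euc N) : ℝ :=
  K2 y * ((max (PV N k L P s κ x μ y + ω2 y) 0) ^ (tS N - 1) -
      PV N k L P s κ x μ y ^ (tS N - 1) -
      (tS N - 1) * PV N k L P s κ x μ y ^ (tS N - 2) * ω2 y) +
    (1 / 2) * ((PV N k L P s κ x μ y + ω2 y) ^ (2 / ((N : ℝ) - 2)) *
        (PU N k L P s κ x μ y + ω1 y) ^ ((N : ℝ) / ((N : ℝ) - 2)) -
      PV N k L P s κ x μ y ^ (2 / ((N : ℝ) - 2)) *
        PU N k L P s κ x μ y ^ ((N : ℝ) / ((N : ℝ) - 2))) -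
    (1 / ((N : ℝ) - 2)) * PV N k L P s κ x μ y ^ ((4 - (N : ℝ)) / ((N : ℝ) - 2)) *
      PU N k L P s κ x μ y ^ ((N : ℝ) / ((N : ℝ) - 2)) * ω2 y -
    ((N : ℝ) / (2 * ((N : ℝ) - 2))) * PV N k L P s κ x μ y ^ (2 / ((N : ℝ) - 2)) *
      PU N k L P s κ x μ y ^ (2 / ((N : ℝ) - 2)) * ω1 y



/-- First-order Taylor bound for `(1 + t) ^ r` near `0`. -/
lemma exists_abs_one_add_rpow_sub_one_le (r : ℝ) :
    ∃ C : ℝ, 0 ≤ C ∧ ∀ t : ℝ, |t| ≤ 1 / 2 → |(1 + t) ^ r - 1| ≤ C * |t| := by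
  have hcont : ContinuousOn (fun t : ℝ => r * (1 + t) ^ (r - 1)) (Set.Icc (-(1 / 2)) (1 / 2)) := by
    refine continuousOn_const.mul (ContinuousOn.rpow_const (by fun_prop) fun t ht => Or.inl ?_)
    have := ht.1
    exact ne_of_gt (by linarith)
  obtain ⟨C, hC⟩ := isCompact_Icc.exists_bound_of_continuousOn hcont
  refine ⟨C, le_trans (norm_nonneg _) (hC 0 (by norm_num)), fun t ht => ?_⟩
  have hderiv : ∀ u ∈ Set.Icc (-(1 / 2) : ℝ) (1 / 2),
      HasDerivWithinAt (fun u : ℝ => (1 + u) ^ r) (r * (1 + u) ^ (r - 1))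
        (Set.Icc (-(1 / 2)) (1 / 2)) u := by
    intro u hu
    have hu1 : (1 : ℝ) + u ≠ 0 := by
      have := hu.1
      exact ne_of_gt (by linarith)
    have h := ((hasDerivAt_id u).const_add 1).rpow_const (p := r) (Or.inl hu1)
    simpa using h.hasDerivWithinAt
  have h := (convex_Icc (-(1 / 2) : ℝ) (1 / 2)).norm_image_sub_le_of_norm_hasDerivWithin_le
    hderiv hC (x := 0) (y := t) (by norm_num) (abs_le.mp ht)
  simpa using h

/-- Second-order Taylor bound for `(1 + t) ^ r` near `0`. -/
lemma exists_abs_one_add_rpow_sub_linear_le (r : ℝ) :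
    ∃ C : ℝ, 0 ≤ C ∧ ∀ t : ℝ, |t| ≤ 1 / 2 → |(1 + t) ^ r - 1 - r * t| ≤ C * t ^ 2 := by
  obtain ⟨C, hC0, hC⟩ := exists_abs_one_add_rpow_sub_one_le (r - 1)
  refine ⟨|r| * C, by positivity, fun t ht => ?_⟩
  have hsub : ∀ u ∈ Set.Icc (-|t|) |t|, |u| ≤ |t| := fun u hu => abs_le.mpr hu
  have hderiv : ∀ u ∈ Set.Icc (-|t|) |t|,
      HasDerivWithinAt (fun u : ℝ => (1 + u) ^ r - 1 - r * u) (r * (1 + u) ^ (r - 1) - r)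
        (Set.Icc (-|t|) |t|) u := by
    intro u hu
    have hu1 : (1 : ℝ) + u ≠ 0 := by
      have := hu.1
      exact ne_of_gt (by linarith)
    have h := ((hasDerivAt_id u).const_add 1).rpow_const (p := r) (Or.inl hu1)
    have h2 := (h.sub_const 1).fun_sub ((hasDerivAt_id u).const_mul r)
    simpa using h2.hasDerivWithinAt
  have hbound : ∀ u ∈ Set.Icc (-|t|) |t|, ‖r * (1 + u) ^ (r - 1) - r‖ ≤ |r| * C * |t| := by
    intro u hu
    have hu' := hsub u hu
    have h1 := hC u (hu'.trans ht)
    calc ‖r * (1 + u) ^ (r - 1) - r‖ = |r| * |(1 + u) ^ (r - 1) - 1| := by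
          rw [Real.norm_eq_abs, ← abs_mul]; ring_nf
      _ ≤ |r| * (C * |u|) := by gcongr
      _ ≤ |r| * C * |t| := by rw [mul_assoc]; gcongr
  have h := (convex_Icc (-|t|) |t|).norm_image_sub_le_of_norm_hasDerivWithin_le
    hderiv hbound (x := 0) (y := t) (by simp) ⟨neg_abs_le t, le_abs_self t⟩
  simp only [add_zero, one_rpow, sub_self, mul_zero, sub_zero, Real.norm_eq_abs] at h
  calc _ ≤ |r| * C * |t| * |t| := h
    _ = |r| * C * t ^ 2 := by rw [mul_assoc, abs_mul_abs_self]; ring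

/-- Second-order Taylor bound for `(1 + u) ^ α * (1 + v) ^ β` near `(0, 0)`. -/
lemma exists_abs_rpow_mul_rpow_sub_linear_le (α β : ℝ) :
    ∃ C : ℝ, 0 ≤ C ∧ ∀ u v : ℝ, |u| ≤ 1 / 2 → |v| ≤ 1 / 2 →
      |(1 + u) ^ α * (1 + v) ^ β - 1 - α * u - β * v| ≤ C * (u ^ 2 + v ^ 2) := by
  obtain ⟨A1, hA1, hA⟩ := exists_abs_one_add_rpow_sub_one_le α
  obtain ⟨B1, hB1, hB⟩ := exists_abs_one_add_rpow_sub_one_le β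
  obtain ⟨A2, hA2, hA'⟩ := exists_abs_one_add_rpow_sub_linear_le α
  obtain ⟨B2, hB2, hB'⟩ := exists_abs_one_add_rpow_sub_linear_le β
  refine ⟨A2 + B2 + A1 * B1, by positivity, fun u v hu hv => ?_⟩
  have hAB : |((1 + u) ^ α - 1) * ((1 + v) ^ β - 1)| ≤ A1 * B1 * (|u| * |v|) := by
    rw [abs_mul]
    calc _ ≤ (A1 * |u|) * (B1 * |v|) :=
          mul_le_mul (hA u hu) (hB v hv) (abs_nonneg _) (by positivity)
      _ = _ := by ring
  have huv : |u| * |v| ≤ u ^ 2 + v ^ 2 := by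
    rw [← sq_abs u, ← sq_abs v]
    nlinarith [sq_nonneg (|u| - |v|), sq_nonneg |u|, sq_nonneg |v|]
  calc |(1 + u) ^ α * (1 + v) ^ β - 1 - α * u - β * v|
      = |((1 + u) ^ α - 1 - α * u) + ((1 + v) ^ β - 1 - β * v) +
          ((1 + u) ^ α - 1) * ((1 + v) ^ β - 1)| := by ring_nf
    _ ≤ |(1 + u) ^ α - 1 - α * u| + |(1 + v) ^ β - 1 - β * v| +
          |((1 + u) ^ α - 1) * ((1 + v) ^ β - 1)| := abs_add_three _ _ _
    _ ≤ A2 * u ^ 2 + B2 * v ^ 2 + A1 * B1 * (|u| * |v|) :=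
        add_le_add (add_le_add (hA' u hu) (hB' v hv)) hAB
    _ ≤ A2 * (u ^ 2 + v ^ 2) + B2 * (u ^ 2 + v ^ 2) + A1 * B1 * (u ^ 2 + v ^ 2) := by
        gcongr
        · nlinarith [sq_nonneg v]
        · nlinarith [sq_nonneg u]
    _ = _ := by ring

/-- Hölder-type bound for power sums of numbers `≥ 1`. -/
lemma rpow_tsum_rpow_neg_le {ι : Type*} {d : ι → ℝ} (hd : ∀ j, 1 ≤ d j) {m τ p C : ℝ}
    (hm : 0 ≤ m) (hp : 1 < p) (hs : Summable fun j => d j ^ (-τ))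
    (hC : ∑' j, d j ^ (-τ) ≤ C) :
    (∑' j, d j ^ (-(m + τ))) ^ p ≤ C ^ (p - 1) * ∑' j, d j ^ (-(m * p + τ)) := by
  have hd0 : ∀ j, 0 < d j := fun j => lt_of_lt_of_le one_pos (hd j)
  have hp0 : 0 < p := by linarith
  have hpq : p.HolderConjugate (p / (p - 1)) := Real.HolderConjugate.conjExponent hp
  have hf : ∀ j, (d j ^ (-(m + τ / p))) ^ p = d j ^ (-(m * p + τ)) := fun j => by
    rw [← Real.rpow_mul (hd0 j).le]; congr 1; field_simp
  have hp1 : 0 < p - 1 := by linarith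
  have hg : ∀ j, (d j ^ (-(τ * (1 - 1 / p)))) ^ (p / (p - 1)) = d j ^ (-τ) := fun j => by
    rw [← Real.rpow_mul (hd0 j).le]; congr 1; field_simp
  have hfg : ∀ j, d j ^ (-(m + τ / p)) * d j ^ (-(τ * (1 - 1 / p))) = d j ^ (-(m + τ)) :=
    fun j => by rw [← Real.rpow_add (hd0 j)]; congr 1; field_simp; ring
  have hsf : Summable fun j => d j ^ (-(m * p + τ)) :=
    hs.of_nonneg_of_le (fun j => (Real.rpow_pos_of_pos (hd0 j) _).le)
      fun j => Real.rpow_le_rpow_of_exponent_le (hd j) (by nlinarith)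
  have hnn : ∀ r : ℝ, 0 ≤ ∑' j, d j ^ r := fun r =>
    tsum_nonneg fun j => (Real.rpow_pos_of_pos (hd0 j) _).le
  have h := Real.inner_le_Lp_mul_Lq_tsum_of_nonneg hpq
    (f := fun j => d j ^ (-(m + τ / p))) (g := fun j => d j ^ (-(τ * (1 - 1 / p))))
    (fun j => (Real.rpow_pos_of_pos (hd0 j) _).le) (fun j => (Real.rpow_pos_of_pos (hd0 j) _).le)
    (by simpa only [hf] using hsf) (by simpa only [hg] using hs)
  simp only [hf, hg, hfg] at h
  calc (∑' j, d j ^ (-(m + τ))) ^ p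
      ≤ ((∑' j, d j ^ (-(m * p + τ))) ^ (1 / p) *
          (∑' j, d j ^ (-τ)) ^ (1 / (p / (p - 1)))) ^ p := by
        gcongr
        exact hnn _
    _ = (∑' j, d j ^ (-(m * p + τ))) * (∑' j, d j ^ (-τ)) ^ (p - 1) := by
        rw [Real.mul_rpow (Real.rpow_nonneg (hnn _) _) (Real.rpow_nonneg (hnn _) _),
          ← Real.rpow_mul (hnn _), ← Real.rpow_mul (hnn _)]
        have e1 : 1 / p * p = 1 := by field_simp
        have e2 : 1 / (p / (p - 1)) * p = p - 1 := by field_simp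
        rw [e1, e2, Real.rpow_one]
    _ ≤ (∑' j, d j ^ (-(m * p + τ))) * C ^ (p - 1) := by
        gcongr
        · exact hnn _
        · exact hnn _
    _ = _ := mul_comm _ _

/-- The integer lattice sum `∑ (1 + ‖n‖) ^ (-τ)` over `ℤ ^ k` converges for `τ > k`. -/
lemma summable_one_add_norm_int_rpow {k : ℕ} (hk : 1 ≤ k) {τ : ℝ} (hτ : (k : ℝ) < τ) :
    Summable fun n : Fin k → ℤ => (1 + ‖n‖) ^ (-τ) := by
  let b := Pi.basisFun ℝ (Fin k)
  let Λ : Submodule ℤ (Fin k → ℝ) := Submodule.span ℤ (Set.range b)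
  have hrank : Module.finrank ℤ Λ = k := by
    rw [Module.finrank_eq_card_basis (b.restrictScalars ℤ)]
    simp
  have hs := ZLattice.summable_norm_sub_rpow (L := Λ) (-τ) (by rw [hrank]; linarith)
    (fun _ => (1 / 2 : ℝ))
  have hmem : ∀ n : Fin k → ℤ, (fun i => (n i : ℝ)) ∈ Λ := fun n => by
    refine (b.mem_span_iff_repr_mem ℤ _).mpr fun i => ⟨n i, ?_⟩
    simp [b]
  let f : (Fin k → ℤ) → Λ := fun n => ⟨fun i => (n i : ℝ), hmem n⟩
  have hf : Function.Injective f := fun n n' h => by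
    funext i
    have := congrFun (congrArg Subtype.val h) i
    simpa [f] using this
  refine (hs.comp_injective hf).of_nonneg_of_le (fun n => by positivity) fun n => ?_
  have hpos : 0 < ‖(f n : Fin k → ℝ) - fun _ => (1 / 2 : ℝ)‖ := by
    rw [norm_pos_iff, sub_ne_zero]
    intro h
    have h0 := congrFun h ⟨0, hk⟩
    simp only [f] at h0
    have h1 : ((2 * n ⟨0, hk⟩ : ℤ) : ℝ) = ((1 : ℤ) : ℝ) := by push_cast; linarith
    have h2 := Int.cast_injective h1
    omega
  have hk0 : (0 : ℝ) ≤ k := k.cast_nonneg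
  refine Real.rpow_le_rpow_of_nonpos hpos ?_ (by linarith)
  refine (pi_norm_le_iff_of_nonneg (by positivity)).mpr fun i => ?_
  have h1 : |(n i : ℝ)| ≤ ‖n‖ := by simpa [Int.norm_eq_abs] using norm_le_pi_norm n i
  simp only [f, Pi.sub_apply, Real.norm_eq_abs]
  calc |(n i : ℝ) - 1 / 2| ≤ |(n i : ℝ)| + |(1 / 2 : ℝ)| := abs_sub _ _
    _ ≤ 1 + ‖n‖ := by rw [abs_of_pos (by norm_num : (0:ℝ) < 1 / 2)]; linarith

/-- The common pointwise form of `N₁` and `N₂`: here `a`, `b` stand for the values of the projected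
bubbles and `w₁`, `w₂` for those of the perturbations. -/
def remainder (N : ℕ) (K a b w₁ w₂ : ℝ) : ℝ :=
  K * ((max (a + w₁) 0) ^ (tS N - 1) - a ^ (tS N - 1) - (tS N - 1) * a ^ (tS N - 2) * w₁) +
    (1 / 2) * ((a + w₁) ^ (2 / ((N : ℝ) - 2)) * (b + w₂) ^ ((N : ℝ) / ((N : ℝ) - 2)) -
      a ^ (2 / ((N : ℝ) - 2)) * b ^ ((N : ℝ) / ((N : ℝ) - 2))) -
    (1 / ((N : ℝ) - 2)) * a ^ ((4 - (N : ℝ)) / ((N : ℝ) - 2)) *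
      b ^ ((N : ℝ) / ((N : ℝ) - 2)) * w₁ -
    ((N : ℝ) / (2 * ((N : ℝ) - 2))) * a ^ (2 / ((N : ℝ) - 2)) * b ^ (2 / ((N : ℝ) - 2)) * w₂

lemma tS_sub_one {N : ℕ} (hN : 5 ≤ N) : tS N - 1 = ((N : ℝ) + 2) / ((N : ℝ) - 2) := by
  have : (5 : ℝ) ≤ N := by exact_mod_cast hN
  have h2 : (N : ℝ) - 2 ≠ 0 := by linarith
  unfold tS
  field_simp
  ring

lemma one_lt_tS_sub_one {N : ℕ} (hN : 5 ≤ N) : 1 < tS N - 1 := by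
  have : (5 : ℝ) ≤ N := by exact_mod_cast hN
  rw [tS_sub_one hN, one_lt_div (by linarith)]
  linarith

/-- The remainder in normalized variables. -/
lemma remainder_mul {N : ℕ} (hN : 5 ≤ N) {K a b u v : ℝ} (ha : 0 < a) (hb : 0 < b)
    (hu : |u| ≤ 1 / 2) (hv : |v| ≤ 1 / 2) :
    remainder N K a b (a * u) (b * v) =
      K * a ^ (tS N - 1) * ((1 + u) ^ (tS N - 1) - 1 - (tS N - 1) * u) +
      (1 / 2) * (a ^ (2 / ((N : ℝ) - 2)) * b ^ ((N : ℝ) / ((N : ℝ) - 2))) *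
        ((1 + u) ^ (2 / ((N : ℝ) - 2)) * (1 + v) ^ ((N : ℝ) / ((N : ℝ) - 2)) - 1 -
          (2 / ((N : ℝ) - 2)) * u - ((N : ℝ) / ((N : ℝ) - 2)) * v) := by
  have hN5 : (5 : ℝ) ≤ N := by exact_mod_cast hN
  have h2 : (N : ℝ) - 2 ≠ 0 := by linarith
  have hu1 : 0 ≤ 1 + u := by linarith [(abs_le.mp hu).1]
  have hv1 : 0 ≤ 1 + v := by linarith [(abs_le.mp hv).1]
  have e1 : a + a * u = a * (1 + u) := by ring
  have e2 : b + b * v = b * (1 + v) := by ring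
  have e3 : a ^ (tS N - 1) = a ^ (tS N - 2) * a := by
    nth_rewrite 3 [← Real.rpow_one a]
    rw [← Real.rpow_add ha]; congr 1; ring
  have e4 : a ^ (2 / ((N : ℝ) - 2)) = a ^ ((4 - (N : ℝ)) / ((N : ℝ) - 2)) * a := by
    nth_rewrite 3 [← Real.rpow_one a]
    rw [← Real.rpow_add ha]; congr 1; field_simp; ring
  have e5 : b ^ ((N : ℝ) / ((N : ℝ) - 2)) = b ^ (2 / ((N : ℝ) - 2)) * b := by
    nth_rewrite 3 [← Real.rpow_one b]
    rw [← Real.rpow_add hb]; congr 1; field_simp; ring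
  unfold remainder
  rw [e1, e2, max_eq_left (by positivity), Real.mul_rpow ha.le hu1, Real.mul_rpow ha.le hu1,
    Real.mul_rpow hb.le hv1, e3, e4, e5]
  field_simp
  ring

lemma exists_abs_remainder_le {N : ℕ} (hN : 5 ≤ N) :
    ∃ C : ℝ, 0 ≤ C ∧ ∀ K a b w₁ w₂ : ℝ, 0 < a → 0 < b → |w₁| ≤ 1 / 2 * a → |w₂| ≤ 1 / 2 * b →
      |remainder N K a b w₁ w₂| ≤
        C * (|K| * a ^ (tS N - 1) + a ^ (2 / ((N : ℝ) - 2)) * b ^ ((N : ℝ) / ((N : ℝ) - 2))) *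
          ((w₁ / a) ^ 2 + (w₂ / b) ^ 2) := by
  obtain ⟨A, hA0, hA⟩ := exists_abs_one_add_rpow_sub_linear_le (tS N - 1)
  obtain ⟨B, hB0, hB⟩ :=
    exists_abs_rpow_mul_rpow_sub_linear_le (2 / ((N : ℝ) - 2)) ((N : ℝ) / ((N : ℝ) - 2))
  refine ⟨A + B, by positivity, fun K a b w₁ w₂ ha hb hw₁ hw₂ => ?_⟩
  obtain ⟨u, rfl⟩ : ∃ u, w₁ = a * u := ⟨w₁ / a, by field_simp⟩
  obtain ⟨v, rfl⟩ : ∃ v, w₂ = b * v := ⟨w₂ / b, by field_simp⟩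
  have hu : |u| ≤ 1 / 2 := by
    rw [abs_mul, abs_of_pos ha, mul_comm] at hw₁
    exact le_of_mul_le_mul_right hw₁ ha
  have hv : |v| ≤ 1 / 2 := by
    rw [abs_mul, abs_of_pos hb, mul_comm] at hw₂
    exact le_of_mul_le_mul_right hw₂ hb
  rw [remainder_mul hN ha hb hu hv, mul_div_cancel_left₀ _ ha.ne', mul_div_cancel_left₀ _ hb.ne']
  set p := tS N - 1
  set α := 2 / ((N : ℝ) - 2)
  set β := (N : ℝ) / ((N : ℝ) - 2)
  have hap : 0 < a ^ p := by positivity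
  have hab : 0 < a ^ α * b ^ β := by positivity
  have h1 : |K * a ^ p * ((1 + u) ^ p - 1 - p * u)| ≤ |K| * a ^ p * (A * (u ^ 2 + v ^ 2)) := by
    rw [abs_mul, abs_mul, abs_of_pos hap]
    gcongr
    exact (hA u hu).trans (by nlinarith [sq_nonneg v])
  have h2 : |(1 / 2) * (a ^ α * b ^ β) * ((1 + u) ^ α * (1 + v) ^ β - 1 - α * u - β * v)| ≤
      a ^ α * b ^ β * (B * (u ^ 2 + v ^ 2)) := by
    rw [abs_mul, abs_mul, abs_of_pos hab, abs_of_pos (by norm_num : (0:ℝ) < 1 / 2)]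
    calc _ ≤ 1 * (a ^ α * b ^ β) * (B * (u ^ 2 + v ^ 2)) := by
          gcongr
          · norm_num
          · exact hB u v hu hv
      _ = _ := by ring
  refine (abs_add_le _ _).trans ((add_le_add h1 h2).trans ?_)
  have h3 : 0 ≤ |K| * a ^ p * (u ^ 2 + v ^ 2) := by positivity
  have h4 : 0 ≤ a ^ α * b ^ β * (u ^ 2 + v ^ 2) := by positivity
  nlinarith [mul_nonneg hB0 h3, mul_nonneg hA0 h4]

lemma rpow_mul_div_sq_le {a w p δ : ℝ} (ha : 0 < a) (hw : |w| ≤ a) (hδ : δ ≤ 1) :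
    a ^ p * (w / a) ^ 2 ≤ a ^ (p - 1 - δ) * |w| ^ (1 + δ) := by
  rcases eq_or_ne w 0 with rfl | hw0
  · have : (0 : ℝ) ≤ a ^ (p - 1 - δ) * |0| ^ (1 + δ) := by positivity
    simpa using this
  have h1 : |w| / a ≤ 1 := (div_le_one ha).mpr hw
  have h2 : (w / a) ^ 2 = (|w| / a) ^ (2 : ℝ) := by
    rw [Real.rpow_two, div_pow, div_pow, sq_abs]
  have h3 : (|w| / a) ^ (2 : ℝ) ≤ (|w| / a) ^ (1 + δ) :=
    Real.rpow_le_rpow_of_exponent_ge (by positivity) h1 (by linarith)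
  rw [h2]
  calc a ^ p * (|w| / a) ^ (2 : ℝ) ≤ a ^ p * (|w| / a) ^ (1 + δ) := by gcongr
    _ = a ^ (p - 1 - δ) * |w| ^ (1 + δ) := by
      rw [Real.div_rpow (abs_nonneg _) ha.le, show p - 1 - δ = p - (1 + δ) by ring,
        Real.rpow_sub ha p]
      ring

/-- Superlinear bound for the remainder when the two bubbles are comparable. -/
lemma exists_abs_remainder_le_rpow {N : ℕ} (hN : 5 ≤ N) (M c : ℝ) {δ : ℝ} (hδ0 : 0 < δ)
    (hδ : δ ≤ 1) :
    ∃ C : ℝ, 0 ≤ C ∧ ∀ K a b w₁ w₂ : ℝ, |K| ≤ M → 0 ≤ a → 0 ≤ b → a ≤ c * b → b ≤ c * a →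
      |w₁| ≤ 1 / 2 * a → |w₂| ≤ 1 / 2 * b →
      |remainder N K a b w₁ w₂| ≤
        C * (a ^ (tS N - 1 - 1 - δ) * |w₁| ^ (1 + δ) +
          b ^ (tS N - 1 - 1 - δ) * |w₂| ^ (1 + δ)) := by
  have hN5 : (5 : ℝ) ≤ N := by exact_mod_cast hN
  have hN2 : 0 < (N : ℝ) - 2 := by linarith
  have hp1 := one_lt_tS_sub_one hN
  obtain ⟨A, hA0, hA⟩ := exists_abs_remainder_le hN
  set β := (N : ℝ) / ((N : ℝ) - 2) with hβ
  refine ⟨A * (|M| + |c| ^ β) * (1 + |c| ^ (tS N - 1)), by positivity,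
    fun K a b w₁ w₂ hK ha hb hac hbc hw₁ hw₂ => ?_⟩
  rcases ha.eq_or_lt with rfl | ha
  · obtain rfl : b = 0 := le_antisymm (by simpa using hbc) hb
    obtain rfl : w₁ = 0 := by simpa using hw₁
    obtain rfl : w₂ = 0 := by simpa using hw₂
    have e1 : tS N - 1 ≠ 0 := by linarith
    have e2 : β ≠ 0 := by positivity
    have e3 : (1 : ℝ) + δ ≠ 0 := by positivity
    have e4 : 2 / ((N : ℝ) - 2) ≠ 0 := by positivity
    simp [remainder, Real.zero_rpow e1, Real.zero_rpow e3, Real.zero_rpow e4]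
  rcases hb.eq_or_lt with rfl | hb
  · simp at hac; linarith
  have hac' : a ≤ |c| * b := hac.trans (by gcongr; exact le_abs_self c)
  have hbc' : b ≤ |c| * a := hbc.trans (by gcongr; exact le_abs_self c)
  have hbβ : b ^ β ≤ |c| ^ β * a ^ β := by
    rw [← Real.mul_rpow (abs_nonneg c) ha.le]
    exact Real.rpow_le_rpow hb.le hbc' (by positivity)
  have hapb : a ^ (tS N - 1) ≤ |c| ^ (tS N - 1) * b ^ (tS N - 1) := by
    rw [← Real.mul_rpow (abs_nonneg c) hb.le]
    exact Real.rpow_le_rpow ha.le hac' (by linarith)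
  have hsplit : a ^ (2 / ((N : ℝ) - 2)) * a ^ β = a ^ (tS N - 1) := by
    rw [← Real.rpow_add ha, tS_sub_one hN, hβ]; congr 1; field_simp; ring
  have hfac : |K| * a ^ (tS N - 1) + a ^ (2 / ((N : ℝ) - 2)) * b ^ β ≤
      (|M| + |c| ^ β) * a ^ (tS N - 1) := by
    calc _ ≤ |M| * a ^ (tS N - 1) + a ^ (2 / ((N : ℝ) - 2)) * (|c| ^ β * a ^ β) :=
          add_le_add (mul_le_mul_of_nonneg_right (hK.trans (le_abs_self M)) (by positivity))
            (mul_le_mul_of_nonneg_left hbβ (by positivity))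
      _ = _ := by rw [← hsplit]; ring
  have t1 : a ^ (tS N - 1) * (w₁ / a) ^ 2 ≤ a ^ (tS N - 1 - 1 - δ) * |w₁| ^ (1 + δ) :=
    rpow_mul_div_sq_le ha (hw₁.trans (by linarith)) hδ
  have t2 : b ^ (tS N - 1) * (w₂ / b) ^ 2 ≤ b ^ (tS N - 1 - 1 - δ) * |w₂| ^ (1 + δ) :=
    rpow_mul_div_sq_le hb (hw₂.trans (by linarith)) hδ
  have t3 : a ^ (tS N - 1) * (w₂ / b) ^ 2 ≤
      |c| ^ (tS N - 1) * (b ^ (tS N - 1 - 1 - δ) * |w₂| ^ (1 + δ)) := by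
    calc _ ≤ (|c| ^ (tS N - 1) * b ^ (tS N - 1)) * (w₂ / b) ^ 2 := by gcongr
      _ = |c| ^ (tS N - 1) * (b ^ (tS N - 1) * (w₂ / b) ^ 2) := by ring
      _ ≤ _ := by gcongr
  set X := a ^ (tS N - 1 - 1 - δ) * |w₁| ^ (1 + δ)
  set Y := b ^ (tS N - 1 - 1 - δ) * |w₂| ^ (1 + δ)
  have hX : 0 ≤ X := by positivity
  have hY : 0 ≤ Y := by positivity
  have hc0 : 0 ≤ |c| ^ (tS N - 1) := by positivity
  calc |remainder N K a b w₁ w₂|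
      ≤ A * (|K| * a ^ (tS N - 1) + a ^ (2 / ((N : ℝ) - 2)) * b ^ β) *
          ((w₁ / a) ^ 2 + (w₂ / b) ^ 2) := hA K a b w₁ w₂ ha hb hw₁ hw₂
    _ ≤ A * ((|M| + |c| ^ β) * a ^ (tS N - 1)) * ((w₁ / a) ^ 2 + (w₂ / b) ^ 2) := by gcongr
    _ = A * (|M| + |c| ^ β) *
          (a ^ (tS N - 1) * (w₁ / a) ^ 2 + a ^ (tS N - 1) * (w₂ / b) ^ 2) := by ring
    _ ≤ A * (|M| + |c| ^ β) * (X + |c| ^ (tS N - 1) * Y) := by gcongr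
    _ ≤ A * (|M| + |c| ^ β) * ((1 + |c| ^ (tS N - 1)) * (X + Y)) := by
        gcongr
        nlinarith [mul_nonneg hc0 hX]
    _ = _ := by ring

lemma lintegral_eq_mul_lintegral_comp_smul {N : ℕ} (f : Euc N → ENNReal) {r : ℝ} (hr : 0 < r) :
    ∫⁻ z, f z = ENNReal.ofReal (r ^ N) * ∫⁻ w, f (r • w) := by
  have h1 := (Homeomorph.smulOfNeZero (α := Euc N) r hr.ne').measurableEmbedding.lintegral_map
    (μ := volume) f
  have h2 : Measure.map (Homeomorph.smulOfNeZero (α := Euc N) r hr.ne') volume =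
      ENNReal.ofReal (r ^ N)⁻¹ • (volume : Measure (Euc N)) := by
    have := Measure.map_addHaar_smul (volume : Measure (Euc N)) hr.ne'
    rw [finrank_euclideanSpace_fin, abs_of_pos (by positivity)] at this
    exact this
  rw [h2, lintegral_smul_measure] at h1
  have h3 : ∫⁻ w, f (r • w) = ENNReal.ofReal (r ^ N)⁻¹ * ∫⁻ z, f z := h1.symm
  rw [h3, ← mul_assoc, ← ENNReal.ofReal_mul (by positivity), mul_inv_cancel₀ (by positivity),
    ENNReal.ofReal_one, one_mul]

/-- The Newtonian kernel integrates to `O(r ^ 2)` over a ball of radius `r`. -/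
lemma exists_lintegral_kernel_ball_le {N : ℕ} (hN : 2 ≤ N) :
    ∃ C : ℝ, 0 ≤ C ∧ ∀ (Y : Euc N) (r : ℝ), 0 < r →
      ∫⁻ z, (Metric.ball 0 r).indicator
        (fun w : Euc N => ENNReal.ofReal (1 / ‖w‖ ^ ((N : ℝ) - 2))) (Y - z) ≤
          ENNReal.ofReal (C * r ^ 2) := by
  have : Nontrivial (Euc N) :=
    Module.nontrivial_of_finrank_pos (R := ℝ) (by rw [finrank_euclideanSpace_fin]; omega)
  set g : Euc N → ℝ := fun w => 1 / ‖w‖ ^ ((N : ℝ) - 2) with hg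
  have hJ : IntegrableOn g (Metric.ball 0 1) volume := by
    refine (integrableOn_fun_norm_addHaar (E := Euc N) volume
      (f := fun t : ℝ => 1 / t ^ ((N : ℝ) - 2)) (r := 1)).mpr ?_
    have h1 : IntegrableOn (fun y : ℝ => y) (Set.Ioo 0 1) volume :=
      (continuous_id.integrableOn_Icc (a := 0) (b := 1)).mono_set Set.Ioo_subset_Icc_self
    refine h1.congr_fun (fun y hy => ?_) measurableSet_Ioo
    have hy0 : (0 : ℝ) < y := hy.1
    rw [finrank_euclideanSpace_fin, smul_eq_mul, ← Real.rpow_natCast, mul_one_div,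
      ← Real.rpow_sub hy0, Nat.cast_sub (by omega)]
    ring_nf
    exact (Real.rpow_one y).symm
  have hfin : ∫⁻ w, (Metric.ball (0 : Euc N) 1).indicator (fun w => ENNReal.ofReal (g w)) w ≠ ⊤ := by
    rw [lintegral_indicator measurableSet_ball]
    exact hJ.lintegral_lt_top.ne
  refine ⟨_, ENNReal.toReal_nonneg
    (a := ∫⁻ w, (Metric.ball (0 : Euc N) 1).indicator (fun w => ENNReal.ofReal (g w)) w),
    fun Y r hr => ?_⟩
  rw [lintegral_sub_left_eq_self (fun z => (Metric.ball 0 r).indicator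
    (fun w : Euc N => ENNReal.ofReal (g w)) z) Y, lintegral_eq_mul_lintegral_comp_smul _ hr]
  have hscale : ∀ w : Euc N, (Metric.ball 0 r).indicator (fun w => ENNReal.ofReal (g w)) (r • w) =
      ENNReal.ofReal (r ^ (-((N : ℝ) - 2))) *
        (Metric.ball 0 1).indicator (fun w => ENNReal.ofReal (g w)) w := by
    intro w
    have hiff : r • w ∈ Metric.ball (0 : Euc N) r ↔ w ∈ Metric.ball (0 : Euc N) 1 := by
      rw [mem_ball_zero_iff, mem_ball_zero_iff, norm_smul, Real.norm_of_nonneg hr.le]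
      exact ⟨fun h => by nlinarith, fun h => by nlinarith⟩
    by_cases hw : w ∈ Metric.ball (0 : Euc N) 1
    · rw [Set.indicator_of_mem (hiff.mpr hw), Set.indicator_of_mem hw,
        ← ENNReal.ofReal_mul (by positivity)]
      congr 1
      simp only [hg]
      rw [norm_smul, Real.norm_of_nonneg hr.le, Real.mul_rpow hr.le (norm_nonneg _),
        Real.rpow_neg hr.le]
      field_simp
    · rw [Set.indicator_of_notMem (fun h => hw (hiff.mp h)), Set.indicator_of_notMem hw, mul_zero]
  simp only [hscale]
  rw [lintegral_const_mul' _ _ ENNReal.ofReal_ne_top, ← mul_assoc,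
    ← ENNReal.ofReal_mul (by positivity)]
  nth_rewrite 1 [← ENNReal.ofReal_toReal hfin]
  rw [← ENNReal.ofReal_mul (by positivity)]
  apply le_of_eq
  congr 1
  rw [← Real.rpow_natCast r N, ← Real.rpow_add hr]
  have : (N : ℝ) + -((N : ℝ) - 2) = (2 : ℕ) := by push_cast; ring
  rw [this, Real.rpow_natCast]
  ring

lemma exists_lintegral_one_add_mul_norm_le (N : ℕ) :
    ∃ C : ℝ, 0 ≤ C ∧ ∀ (x : Euc N) (μ : ℝ), 0 < μ →
      ∫⁻ z, ENNReal.ofReal ((1 + μ * ‖z - x‖) ^ (-((N : ℝ) + 2))) ≤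
        ENNReal.ofReal (C * μ ^ (-(N : ℝ))) := by
  have hfin : ∫⁻ w : Euc N, ENNReal.ofReal ((1 + ‖w‖) ^ (-((N : ℝ) + 2))) ≠ ⊤ :=
    (finite_integral_one_add_norm (E := Euc N) (μ := volume)
      (by rw [finrank_euclideanSpace_fin]; linarith)).ne
  refine ⟨_, ENNReal.toReal_nonneg
    (a := ∫⁻ w : Euc N, ENNReal.ofReal ((1 + ‖w‖) ^ (-((N : ℝ) + 2)))), fun x μ hμ => ?_⟩
  rw [lintegral_sub_right_eq_self
    (fun z : Euc N => ENNReal.ofReal ((1 + μ * ‖z‖) ^ (-((N : ℝ) + 2)))) x,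
    lintegral_eq_mul_lintegral_comp_smul _ (inv_pos.mpr hμ)]
  have hscale : ∀ w : Euc N, μ * ‖μ⁻¹ • w‖ = ‖w‖ := fun w => by
    rw [norm_smul, Real.norm_of_nonneg (inv_pos.mpr hμ).le, mul_inv_cancel_left₀ hμ.ne']
  simp only [hscale]
  nth_rewrite 1 [← ENNReal.ofReal_toReal hfin]
  rw [← ENNReal.ofReal_mul (by positivity), Real.rpow_neg hμ.le, Real.rpow_natCast, inv_pow,
    mul_comm]

/-- The Newtonian potential of a concentrated density decays like the Newtonian kernel. -/
lemma exists_lintegral_kernel_mul_le {N : ℕ} (hN : 2 ≤ N) :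
    ∃ C : ℝ, 0 ≤ C ∧ ∀ (x Y : Euc N) (μ : ℝ), 0 < μ →
      ∫⁻ z, ENNReal.ofReal (1 / ‖Y - z‖ ^ ((N : ℝ) - 2) *
          (1 + μ * ‖z - x‖) ^ (-((N : ℝ) + 2))) ≤
        ENNReal.ofReal (C * (μ ^ (-2 : ℝ) * (1 + μ * ‖Y - x‖) ^ (-((N : ℝ) - 2)))) := by
  obtain ⟨A, hA0, hA⟩ := exists_lintegral_kernel_ball_le hN
  obtain ⟨B, hB0, hB⟩ := exists_lintegral_one_add_mul_norm_le N
  have hN2 : (2 : ℝ) ≤ N := by exact_mod_cast hN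
  refine ⟨2 ^ ((N : ℝ) - 2) * B + 2 ^ (N : ℝ) * A, by positivity, fun x Y μ hμ => ?_⟩
  set R := 1 + μ * ‖Y - x‖ with hR
  have hR1 : 1 ≤ R := by rw [hR]; nlinarith [mul_nonneg hμ.le (norm_nonneg (Y - x))]
  have hR0 : 0 < R := by linarith
  set r := R / (2 * μ) with hr
  have hr0 : 0 < r := by positivity
  have hμr : μ * r = R / 2 := by rw [hr]; field_simp
  have hpt : ∀ z : Euc N, ENNReal.ofReal (1 / ‖Y - z‖ ^ ((N : ℝ) - 2) *
          (1 + μ * ‖z - x‖) ^ (-((N : ℝ) + 2))) ≤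
        ENNReal.ofReal (r ^ (-((N : ℝ) - 2))) *
          ENNReal.ofReal ((1 + μ * ‖z - x‖) ^ (-((N : ℝ) + 2))) +
        ENNReal.ofReal ((R / 2) ^ (-((N : ℝ) + 2))) * (Metric.ball 0 r).indicator
          (fun w : Euc N => ENNReal.ofReal (1 / ‖w‖ ^ ((N : ℝ) - 2))) (Y - z) := by
    intro z
    by_cases hz : Y - z ∈ Metric.ball (0 : Euc N) r
    · refine le_add_left ?_
      rw [Set.indicator_of_mem hz, ← ENNReal.ofReal_mul (by positivity), mul_comm]
      apply ENNReal.ofReal_le_ofReal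
      gcongr ?_ * _
      refine Real.rpow_le_rpow_of_nonpos (by positivity) ?_ (by linarith)
      have h1 : ‖Y - x‖ ≤ ‖Y - z‖ + ‖z - x‖ := norm_sub_le_norm_sub_add_norm_sub _ _ _
      have h2 : ‖Y - z‖ < r := mem_ball_zero_iff.mp hz
      have h3 : μ * ‖Y - x‖ ≤ μ * (r + ‖z - x‖) := by gcongr; linarith
      rw [mul_add, hμr] at h3
      linarith
    · refine le_add_right ?_
      rw [← ENNReal.ofReal_mul (by positivity)]
      apply ENNReal.ofReal_le_ofReal
      have h2 : r ≤ ‖Y - z‖ := by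
        rw [mem_ball_zero_iff, not_lt] at hz; exact hz
      rw [Real.rpow_neg hr0.le, one_div]
      gcongr
  refine (lintegral_mono hpt).trans ?_
  have hmeas : Measurable fun z : Euc N => ENNReal.ofReal (r ^ (-((N : ℝ) - 2))) *
          ENNReal.ofReal ((1 + μ * ‖z - x‖) ^ (-((N : ℝ) + 2))) := by fun_prop
  rw [lintegral_add_left hmeas, lintegral_const_mul' _ _ ENNReal.ofReal_ne_top,
    lintegral_const_mul' _ _ ENNReal.ofReal_ne_top]
  refine (add_le_add (mul_le_mul_right (hB x μ hμ) _) (mul_le_mul_right (hA Y r hr0) _)).trans ?_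
  rw [← ENNReal.ofReal_mul (by positivity), ← ENNReal.ofReal_mul (by positivity),
    ← ENNReal.ofReal_add (by positivity) (by positivity)]
  apply ENNReal.ofReal_le_ofReal
  rw [add_mul]
  have key1 : r ^ (-((N : ℝ) - 2)) * (B * μ ^ (-(N : ℝ))) =
      2 ^ ((N : ℝ) - 2) * B * (μ ^ (-2 : ℝ) * R ^ (-((N : ℝ) - 2))) := by
    have : μ ^ (-(N : ℝ)) = μ ^ (-2 : ℝ) * μ ^ (-((N : ℝ) - 2)) := by
      rw [← Real.rpow_add hμ]; congr 1; ring
    have h2 : r ^ (-((N : ℝ) - 2)) * μ ^ (-((N : ℝ) - 2)) =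
        2 ^ ((N : ℝ) - 2) * R ^ (-((N : ℝ) - 2)) := by
      rw [← Real.mul_rpow hr0.le hμ.le, mul_comm r, hμr, div_eq_inv_mul,
        Real.mul_rpow (by positivity) hR0.le, Real.inv_rpow (by norm_num),
        ← Real.rpow_neg (by norm_num), neg_neg]
    rw [this]
    linear_combination B * μ ^ (-2 : ℝ) * h2
  have key2 : (R / 2) ^ (-((N : ℝ) + 2)) * (A * r ^ 2) ≤
      2 ^ (N : ℝ) * A * (μ ^ (-2 : ℝ) * R ^ (-((N : ℝ) - 2))) := by
    have h1 : r ^ 2 = (R / 2) ^ (2 : ℝ) * μ ^ (-2 : ℝ) := by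
      rw [← hμr, Real.mul_rpow hμ.le hr0.le, Real.rpow_neg hμ.le]
      simp only [Real.rpow_two]
      field_simp
    have h2 : (R / 2) ^ (-((N : ℝ) + 2)) * (R / 2) ^ (2 : ℝ) = 2 ^ (N : ℝ) * R ^ (-(N : ℝ)) := by
      rw [← Real.rpow_add (by positivity), div_eq_inv_mul, Real.mul_rpow (by positivity) hR0.le,
        Real.inv_rpow (by norm_num), ← Real.rpow_neg (by norm_num)]
      ring_nf
    have h3 : R ^ (-(N : ℝ)) ≤ R ^ (-((N : ℝ) - 2)) :=
      Real.rpow_le_rpow_of_exponent_le hR1 (by linarith)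
    calc _ = ((R / 2) ^ (-((N : ℝ) + 2)) * (R / 2) ^ (2 : ℝ)) * A * μ ^ (-2 : ℝ) := by
          rw [h1]; ring
      _ = (2 ^ (N : ℝ) * R ^ (-(N : ℝ))) * A * μ ^ (-2 : ℝ) := by rw [h2]
      _ ≤ (2 ^ (N : ℝ) * R ^ (-((N : ℝ) - 2))) * A * μ ^ (-2 : ℝ) := by gcongr
      _ = _ := by ring
  linarith

/-- The centers `x_j` are spread like the lattice, uniformly over the strip. -/
lemma exists_summable_centers {N k : ℕ} (hk : 1 ≤ k) (hkN : k ≤ N) {P : ℕ → Euc N}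
    (hP : LatticeEnum N k P) {τ : ℝ} (hτ : (k : ℝ) < τ) :
    ∃ C : ℝ, 0 ≤ C ∧ ∀ (L μ : ℝ) (x y : Euc N), 1 ≤ L → 1 ≤ μ → ‖x‖ ≤ 1 → y ∈ strip N k L →
      (Summable fun j => (1 + μ * ‖y - xc L P x j‖) ^ (-τ)) ∧
        ∑' j, (1 + μ * ‖y - xc L P x j‖) ^ (-τ) ≤ C := by
  have hτ0 : 0 < τ := lt_of_le_of_lt k.cast_nonneg hτ
  have hmem : ∀ j, P j ∈ Qlat N k := fun j => hP.2.1 ▸ Set.mem_range_self j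
  have hJ : ∀ (j : ℕ) (i : Fin N), ∃ m : ℤ, P j i = (m : ℝ) := fun j => (hmem j).1
  choose m hm using hJ
  let n : ℕ → Fin k → ℤ := fun j i => m j (Fin.castLE hkN i)
  have hn : Function.Injective n := by
    intro j j' h
    refine hP.1 ?_
    ext i
    by_cases hi : (i : ℕ) < k
    · have := congrFun h ⟨i, hi⟩
      rw [hm, hm]
      exact_mod_cast this
    · rw [(hmem j).2 i (not_lt.mp hi), (hmem j').2 i (not_lt.mp hi)]
  have hs : Summable fun j => 3 ^ τ * (1 + ‖n j‖) ^ (-τ) :=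
    ((summable_one_add_norm_int_rpow hk hτ).comp_injective hn).mul_left _
  refine ⟨∑' j, 3 ^ τ * (1 + ‖n j‖) ^ (-τ), tsum_nonneg fun j => by positivity,
    fun L μ x y hL hμ hx hy => ?_⟩
  have hle : ∀ j, (1 + μ * ‖y - xc L P x j‖) ^ (-τ) ≤ 3 ^ τ * (1 + ‖n j‖) ^ (-τ) := by
    intro j
    set t := 1 + μ * ‖y - xc L P x j‖ with ht
    have ht1 : 1 + ‖y - xc L P x j‖ ≤ t := by
      rw [ht]; nlinarith [norm_nonneg (y - xc L P x j)]
    have ht0 : 1 ≤ t := le_trans (by linarith [norm_nonneg (y - xc L P x j)]) ht1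
    have hcoord : ‖n j‖ ≤ 3 * t - 1 := by
      refine (pi_norm_le_iff_of_nonneg (by linarith)).mpr fun i => ?_
      set i' : Fin N := Fin.castLE hkN i
      have h1 : |(y - xc L P x j) i'| ≤ ‖y - xc L P x j‖ := by
        simpa using PiLp.norm_apply_le (y - xc L P x j) i'
      have h2 : (y - xc L P x j) i' = y i' - x i' + L * P j i' := by
        simp [xc]; ring
      have h3 : |x i'| ≤ 1 := by
        have := PiLp.norm_apply_le x i'
        rw [Real.norm_eq_abs] at this
        exact this.trans hx
      have h4 : |y i'| ≤ L / 2 := hy i' i.2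
      have h5 : L * |P j i'| ≤ |y i' - x i' + L * P j i'| + |y i'| + |x i'| := by
        calc L * |P j i'| = |(y i' - x i' + L * P j i') - y i' + x i'| := by
              rw [show (y i' - x i' + L * P j i') - y i' + x i' = L * P j i' by ring, abs_mul,
                abs_of_pos (by linarith : 0 < L)]
          _ ≤ |(y i' - x i' + L * P j i') - y i'| + |x i'| := abs_add_le _ _
          _ ≤ _ := by gcongr; exact abs_sub _ _
      rw [h2] at h1
      have h6 : ‖n j i‖ = |P j i'| := by rw [hm, Int.norm_eq_abs]
      rw [h6]
      by_contra hcon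
      push Not at hcon
      have h7 : |P j i'| - 3 / 2 ≤ L * (|P j i'| - 3 / 2) := by nlinarith
      linarith
    calc t ^ (-τ) ≤ (3⁻¹ * (1 + ‖n j‖)) ^ (-τ) :=
          Real.rpow_le_rpow_of_nonpos (by positivity) (by linarith) (by linarith)
      _ = 3 ^ τ * (1 + ‖n j‖) ^ (-τ) := by
          rw [Real.mul_rpow (by norm_num) (by positivity), Real.inv_rpow (by norm_num),
            ← Real.rpow_neg (by norm_num), neg_neg]
  have hmu : 0 ≤ μ := by linarith
  have hsum := hs.of_nonneg_of_le (fun j => by positivity) hle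
  exact ⟨hsum, hsum.tsum_le_tsum hle hs⟩

/-- The Green potential of `W ^ (2* - 1)`, of which both projected bubbles are multiples. -/
def bubblePotential (N k : ℕ) (L : ℝ) (P : ℕ → Euc N) (x : Euc N) (μ : ℝ) (y : Euc N) : ℝ :=
  ∫ z in strip N k L, Green N L P y z * Wb N x μ z ^ (tS N - 1)

lemma Wb_pos {N : ℕ} (hN : 5 ≤ N) (x : Euc N) {μ : ℝ} (hμ : 0 < μ) (y : Euc N) :
    0 < Wb N x μ y := by
  have hN5 : (5 : ℝ) ≤ N := by exact_mod_cast hN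
  have : 0 < (N : ℝ) * ((N : ℝ) - 2) := mul_pos (by linarith) (by linarith)
  unfold Wb
  positivity

lemma exists_setIntegral_eq_mul_bubblePotential {N : ℕ} (hN : 5 ≤ N) (k : ℕ) (P : ℕ → Euc N)
    {a b : ℝ} (ha : 0 < a) (hb : 0 < b) :
    ∃ c : ℝ, 0 < c ∧ ∀ (L : ℝ) (x : Euc N) (μ : ℝ) (y : Euc N), 0 < μ →
      ∫ z in strip N k L, Green N L P y z * ((a * Wb N x μ z) ^ (tS N - 1) +
        (1 / 2) * (a * Wb N x μ z) ^ (tS N / 2 - 1) * (b * Wb N x μ z) ^ (tS N / 2)) =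
      c * bubblePotential N k L P x μ y := by
  refine ⟨a ^ (tS N - 1) + (1 / 2) * a ^ (tS N / 2 - 1) * b ^ (tS N / 2), by positivity,
    fun L x μ y hμ => ?_⟩
  rw [bubblePotential, ← integral_const_mul]
  congr 1
  funext z
  have hW := Wb_pos hN x hμ z
  rw [Real.mul_rpow ha.le hW.le, Real.mul_rpow ha.le hW.le, Real.mul_rpow hb.le hW.le]
  have : Wb N x μ z ^ (tS N - 1) = Wb N x μ z ^ (tS N / 2 - 1) * Wb N x μ z ^ (tS N / 2) := by
    rw [← Real.rpow_add hW]; congr 1; ring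
  rw [this]
  ring

lemma exists_Wb_rpow_le {N : ℕ} (hN : 5 ≤ N) :
    ∃ C : ℝ, 0 ≤ C ∧ ∀ (x z : Euc N) (μ : ℝ), 0 < μ →
      Wb N x μ z ^ (tS N - 1) ≤
        C * μ ^ (((N : ℝ) + 2) / 2) * (1 + μ * ‖z - x‖) ^ (-((N : ℝ) + 2)) := by
  have hN5 : (5 : ℝ) ≤ N := by exact_mod_cast hN
  have hN2 : (N : ℝ) - 2 ≠ 0 := by linarith
  have hNN : 0 < (N : ℝ) * ((N : ℝ) - 2) := mul_pos (by linarith) (by linarith)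
  set A := ((N : ℝ) * ((N : ℝ) - 2)) ^ (((N : ℝ) - 2) / 4) with hA
  have hA0 : 0 < A := by positivity
  refine ⟨A ^ (tS N - 1) * 2 ^ (((N : ℝ) + 2) / 2), by positivity, fun x z μ hμ => ?_⟩
  have hexp : ((N : ℝ) - 2) / 2 * (tS N - 1) = ((N : ℝ) + 2) / 2 := by
    rw [tS_sub_one hN]; field_simp
  set t := μ * ‖z - x‖ with ht
  have ht0 : 0 ≤ t := by positivity
  have hq : μ ^ 2 * ‖z - x‖ ^ 2 = t ^ 2 := by rw [ht]; ring
  have hlow : (1 + t) ^ (2 : ℝ) / 2 ≤ 1 + t ^ 2 := by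
    rw [Real.rpow_two]; nlinarith [sq_nonneg (t - 1)]
  have hW : Wb N x μ z ^ (tS N - 1) =
      A ^ (tS N - 1) * μ ^ (((N : ℝ) + 2) / 2) * (1 + t ^ 2) ^ (-(((N : ℝ) + 2) / 2)) := by
    rw [Wb, hq, Real.div_rpow (by positivity) (by positivity), Real.mul_rpow (by positivity)
      (by positivity), ← Real.rpow_mul hμ.le,
      ← Real.rpow_mul (by positivity : (0 : ℝ) ≤ 1 + t ^ 2), hexp,
      Real.rpow_neg (by positivity)]
    ring
  rw [hW]
  calc _ ≤ A ^ (tS N - 1) * μ ^ (((N : ℝ) + 2) / 2) *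
        ((1 + t) ^ (2 : ℝ) / 2) ^ (-(((N : ℝ) + 2) / 2)) := by
        gcongr ?_ * ?_
        exact Real.rpow_le_rpow_of_nonpos (by positivity) hlow (by linarith)
    _ = _ := by
        rw [Real.div_rpow (by positivity) (by norm_num),
          ← Real.rpow_mul (by positivity : (0 : ℝ) ≤ 1 + t),
          Real.rpow_neg (by norm_num : (0 : ℝ) ≤ 2), div_inv_eq_mul,
          show (2 : ℝ) * -(((N : ℝ) + 2) / 2) = -((N : ℝ) + 2) by ring]
        ring

lemma exists_abs_bubblePotential_le {N : ℕ} (hN : 5 ≤ N) :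
    ∃ C : ℝ, 0 ≤ C ∧ ∀ (k : ℕ) (L : ℝ) (P : ℕ → Euc N) (x : Euc N) (μ : ℝ) (y : Euc N), 0 < μ →
      (Summable fun j => (1 + μ * ‖y - xc L P x j‖) ^ (-((N : ℝ) - 2))) →
      |bubblePotential N k L P x μ y| ≤ C * (μ ^ (((N : ℝ) - 2) / 2) *
        ∑' j, (1 + μ * ‖y - xc L P x j‖) ^ (-((N : ℝ) - 2))) := by
  have hN5 : (5 : ℝ) ≤ N := by exact_mod_cast hN
  obtain ⟨A, hA0, hA⟩ := exists_Wb_rpow_le hN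
  obtain ⟨B, hB0, hB⟩ := exists_lintegral_kernel_mul_le (N := N) (by omega)
  set cΓ : ℝ := 1 / (((N : ℝ) - 2) * sphereArea N) with hcΓ
  have hcΓ0 : 0 ≤ cΓ := by
    have : 0 ≤ sphereArea N := by unfold sphereArea; positivity
    have : 0 ≤ (N : ℝ) - 2 := by linarith
    positivity
  have hΓ : ∀ Y z : Euc N, Γfun N Y z = cΓ * (1 / ‖Y - z‖ ^ ((N : ℝ) - 2)) := fun Y z => by
    rw [Γfun, hcΓ, one_div_mul_one_div]
  have hΓ0 : ∀ Y z : Euc N, 0 ≤ Γfun N Y z := fun Y z => by rw [hΓ]; positivity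
  refine ⟨cΓ * A * B, by positivity, fun k L P x μ y hμ hs => ?_⟩
  have hW0 : ∀ z, 0 ≤ Wb N x μ z ^ (tS N - 1) := fun z =>
    Real.rpow_nonneg (Wb_pos hN x hμ z).le _
  have hd : ∀ j, y + L • P j - x = y - xc L P x j := fun j => by simp only [xc]; abel
  set D := cΓ * A * μ ^ (((N : ℝ) + 2) / 2) with hD
  have hD0 : 0 ≤ D := by positivity
  set E : ℕ → Euc N → ENNReal := fun j z =>
    ENNReal.ofReal D * ENNReal.ofReal (1 / ‖y + L • P j - z‖ ^ ((N : ℝ) - 2) *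
          (1 + μ * ‖z - x‖) ^ (-((N : ℝ) + 2))) with hE
  have hterm : ∀ j z, ENNReal.ofReal (Γfun N (y + L • P j) z * Wb N x μ z ^ (tS N - 1)) ≤ E j z := by
    intro j z
    simp only [hE]
    rw [← ENNReal.ofReal_mul hD0]
    apply ENNReal.ofReal_le_ofReal
    rw [hΓ]
    calc _ ≤ cΓ * (1 / ‖y + L • P j - z‖ ^ ((N : ℝ) - 2)) *
          (A * μ ^ (((N : ℝ) + 2) / 2) * (1 + μ * ‖z - x‖) ^ (-((N : ℝ) + 2))) := by
          gcongr
          exact hA x z μ hμ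
      _ = _ := by rw [hD]; ring
  have hpt : ∀ z, ENNReal.ofReal ‖Green N L P y z * Wb N x μ z ^ (tS N - 1)‖ ≤ ∑' j, E j z := by
    intro z
    by_cases hsum : Summable fun j => Γfun N (y + L • P j) z
    · have h0 : 0 ≤ Green N L P y z := tsum_nonneg fun j => hΓ0 _ _
      rw [Real.norm_of_nonneg (mul_nonneg h0 (hW0 z)), Green, ← tsum_mul_right,
        ENNReal.ofReal_tsum_of_nonneg (fun j => mul_nonneg (hΓ0 _ _) (hW0 z)) (hsum.mul_right _)]
      exact ENNReal.tsum_le_tsum fun j => hterm j z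
    · rw [Green, tsum_eq_zero_of_not_summable hsum]
      simp
  have hJ : ∀ j, ∫⁻ z, E j z ≤
      ENNReal.ofReal (D * B * μ ^ (-2 : ℝ) * (1 + μ * ‖y - xc L P x j‖) ^ (-((N : ℝ) - 2))) := by
    intro j
    rw [hE, lintegral_const_mul' _ _ ENNReal.ofReal_ne_top]
    refine (mul_le_mul_right (hB x (y + L • P j) μ hμ) _).trans (le_of_eq ?_)
    rw [← ENNReal.ofReal_mul hD0, hd]
    congr 1
    ring
  have hmeas : ∀ j, AEMeasurable (E j) volume := fun j => by
    apply Measurable.aemeasurable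
    rw [hE]
    fun_prop
  have hd0 : ∀ j, 0 ≤ D * B * μ ^ (-2 : ℝ) * (1 + μ * ‖y - xc L P x j‖) ^ (-((N : ℝ) - 2)) :=
    fun j => by positivity
  have htotal : ∫⁻ z in strip N k L,
      ENNReal.ofReal ‖Green N L P y z * Wb N x μ z ^ (tS N - 1)‖ ≤
      ENNReal.ofReal (∑' j, D * B * μ ^ (-2 : ℝ) *
        (1 + μ * ‖y - xc L P x j‖) ^ (-((N : ℝ) - 2))) := by
    calc _ ≤ ∫⁻ z, ENNReal.ofReal ‖Green N L P y z * Wb N x μ z ^ (tS N - 1)‖ :=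
          setLIntegral_le_lintegral _ _
      _ ≤ ∫⁻ z, ∑' j, E j z := lintegral_mono hpt
      _ = ∑' j, ∫⁻ z, E j z := lintegral_tsum hmeas
      _ ≤ ∑' j, ENNReal.ofReal (D * B * μ ^ (-2 : ℝ) *
            (1 + μ * ‖y - xc L P x j‖) ^ (-((N : ℝ) - 2))) := ENNReal.tsum_le_tsum hJ
      _ = _ := (ENNReal.ofReal_tsum_of_nonneg hd0 (hs.mul_left _)).symm
  have hfinal := (norm_integral_le_lintegral_norm
    (μ := volume.restrict (strip N k L))
    (fun z => Green N L P y z * Wb N x μ z ^ (tS N - 1))).trans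
    (ENNReal.toReal_le_of_le_ofReal (tsum_nonneg hd0) htotal)
  rw [tsum_mul_left] at hfinal
  refine hfinal.trans (le_of_eq ?_)
  have hmu : μ ^ (((N : ℝ) + 2) / 2) * μ ^ (-2 : ℝ) = μ ^ (((N : ℝ) - 2) / 2) := by
    rw [← Real.rpow_add hμ]; congr 1; ring
  rw [hD, ← hmu]
  ring

lemma wStar_eq {N : ℕ} {L : ℝ} {P : ℕ → Euc N} {x : Euc N} {μ : ℝ} (τ : ℝ) (y : Euc N)
    (hμ : 0 ≤ μ) :
    wStar N L P x μ τ y = σw x μ τ y * (μ ^ (((N : ℝ) - 2) / 2) *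
      ∑' j, (1 + μ * ‖y - xc L P x j‖) ^ (-(((N : ℝ) - 2) / 2 + τ))) := by
  rw [wStar, ← tsum_mul_left (a := μ ^ (((N : ℝ) - 2) / 2))]
  congr 1
  refine tsum_congr fun j => ?_
  rw [Real.rpow_neg (by positivity), div_eq_mul_inv]

lemma wStarStar_eq {N : ℕ} {L : ℝ} {P : ℕ → Euc N} {x : Euc N} {μ : ℝ} (τ : ℝ) (y : Euc N)
    (hμ : 0 ≤ μ) :
    wStarStar N L P x μ τ y = σw x μ τ y * (μ ^ (((N : ℝ) + 2) / 2) *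
      ∑' j, (1 + μ * ‖y - xc L P x j‖) ^ (-(((N : ℝ) + 2) / 2 + τ))) := by
  rw [wStarStar, ← tsum_mul_left (a := μ ^ (((N : ℝ) + 2) / 2))]
  congr 1
  refine tsum_congr fun j => ?_
  rw [Real.rpow_neg (by positivity), div_eq_mul_inv]

lemma σw_pos {N : ℕ} (x : Euc N) {μ : ℝ} (hμ : 0 < μ) (τ : ℝ) (y : Euc N) : 0 < σw x μ τ y :=
  lt_min one_pos (by positivity)

/-- Comparison of the two weights with each other and with the projected bubbles: with
`wStar = σ * S`, the quantity `σ * S ^ (2* - 1)` is controlled by `wStarStar`. -/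
lemma exists_weight_bounds {N k : ℕ} (hN : 5 ≤ N) (hk1 : 1 ≤ k)
    {P : ℕ → Euc N} (hP : LatticeEnum N k P) {τ : ℝ}
    (hτk : (k : ℝ) < τ) (hτN : τ < ((N : ℝ) - 2) / 2) :
    ∃ C : ℝ, 0 ≤ C ∧ ∀ (L μ : ℝ) (x y : Euc N), 1 ≤ L → 1 ≤ μ → ‖x‖ ≤ 1 → y ∈ strip N k L →
      ∃ S σ : ℝ, 0 < S ∧ 0 < σ ∧ σ ≤ 1 ∧ wStar N L P x μ τ y = σ * S ∧
        σ * S ^ (tS N - 1) ≤ C * wStarStar N L P x μ τ y ∧ 0 < wStarStar N L P x μ τ y ∧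
        |bubblePotential N k L P x μ y| ≤ C * S := by
  have hN5 : (5 : ℝ) ≤ N := by exact_mod_cast hN
  have hkN : k ≤ N := by
    have : (k : ℝ) ≤ N := by linarith
    exact_mod_cast this
  have hp1 := one_lt_tS_sub_one hN
  have hτ0 : 0 < τ := lt_of_le_of_lt k.cast_nonneg hτk
  obtain ⟨A, hA0, hA⟩ := exists_summable_centers hk1 hkN hP hτk
  obtain ⟨B, hB0, hB⟩ := exists_abs_bubblePotential_le hN
  refine ⟨A ^ (tS N - 1 - 1) + B, by positivity, fun L μ x y hL hμ hx hy => ?_⟩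
  have hμ0 : 0 < μ := by linarith
  obtain ⟨hs, hsA⟩ := hA L μ x y hL hμ hx hy
  set d : ℕ → ℝ := fun j => 1 + μ * ‖y - xc L P x j‖ with hd
  have hd1 : ∀ j, 1 ≤ d j := fun j => by
    have : 0 ≤ μ * ‖y - xc L P x j‖ := by positivity
    simp only [hd]; linarith
  have hd0 : ∀ j, 0 < d j := fun j => lt_of_lt_of_le one_pos (hd1 j)
  have hsum : ∀ r : ℝ, r ≤ -τ → Summable fun j => d j ^ r := fun r hr =>
    hs.of_nonneg_of_le (fun j => (Real.rpow_pos_of_pos (hd0 j) _).le)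
      fun j => Real.rpow_le_rpow_of_exponent_le (hd1 j) hr
  have hpos : ∀ r : ℝ, r ≤ -τ → 0 < ∑' j, d j ^ r := fun r hr =>
    (hsum r hr).tsum_pos (fun j => (Real.rpow_pos_of_pos (hd0 j) _).le) 0
      (Real.rpow_pos_of_pos (hd0 0) _)
  have hσ := σw_pos x hμ0 τ y
  set T := ∑' j, d j ^ (-(((N : ℝ) - 2) / 2 + τ)) with hT
  have hT0 : 0 < T := hpos _ (by linarith)
  set Q := ∑' j, d j ^ (-(((N : ℝ) + 2) / 2 + τ)) with hQ
  have hQ0 : 0 < Q := hpos _ (by linarith)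
  have hSS : wStarStar N L P x μ τ y = σw x μ τ y * (μ ^ (((N : ℝ) + 2) / 2) * Q) :=
    wStarStar_eq τ y hμ0.le
  have hSSpos : 0 < wStarStar N L P x μ τ y := by rw [hSS]; positivity
  have hexp : ((N : ℝ) - 2) / 2 * (tS N - 1) = ((N : ℝ) + 2) / 2 := by
    have : (N : ℝ) - 2 ≠ 0 := by linarith
    rw [tS_sub_one hN]; field_simp
  refine ⟨μ ^ (((N : ℝ) - 2) / 2) * T, σw x μ τ y, by positivity, hσ, min_le_left _ _,
    wStar_eq τ y hμ0.le, ?_, hSSpos, ?_⟩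
  · have hH := rpow_tsum_rpow_neg_le hd1 (m := ((N : ℝ) - 2) / 2) (by linarith) hp1 hs hsA
    rw [hexp] at hH
    rw [Real.mul_rpow (by positivity) hT0.le, ← Real.rpow_mul hμ0.le, hexp]
    calc _ ≤ σw x μ τ y * (μ ^ (((N : ℝ) + 2) / 2) * (A ^ (tS N - 1 - 1) * Q)) := by gcongr
      _ = A ^ (tS N - 1 - 1) * wStarStar N L P x μ τ y := by rw [hSS]; ring
      _ ≤ _ := by
        gcongr
        linarith
  · refine (hB k L P x μ y hμ0 (hsum _ (by linarith))).trans ?_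
    have hle : ∑' j, d j ^ (-((N : ℝ) - 2)) ≤ T :=
      (hsum _ (by linarith)).tsum_le_tsum
        (fun j => Real.rpow_le_rpow_of_exponent_le (hd1 j) (by linarith)) (hsum _ (by linarith))
    have hA' : 0 ≤ A ^ (tS N - 1 - 1) := by positivity
    calc _ ≤ B * (μ ^ (((N : ℝ) - 2) / 2) * T) := by gcongr
      _ ≤ _ := by
        gcongr
        linarith

lemma rpow_mul_rpow_le_weight {a w A S σ n ε δ : ℝ} (ha : 0 ≤ a) (hA : 0 ≤ A) (hε : 0 ≤ ε)
    (hδ : 0 ≤ δ) (hS : 0 < S) (hσ : 0 < σ) (hσ1 : σ ≤ 1) (hn : 0 ≤ n) (haS : a ≤ A * S)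
    (hw : |w| ≤ n * (σ * S)) :
    a ^ ε * |w| ^ (1 + δ) ≤ A ^ ε * n ^ (1 + δ) * (σ * S ^ (ε + (1 + δ))) := by
  have hσδ : σ ^ (1 + δ) ≤ σ := by
    simpa using Real.rpow_le_rpow_of_exponent_ge hσ hσ1 (by linarith : (1 : ℝ) ≤ 1 + δ)
  calc a ^ ε * |w| ^ (1 + δ) ≤ (A * S) ^ ε * (n * (σ * S)) ^ (1 + δ) := by gcongr
    _ = A ^ ε * n ^ (1 + δ) * (σ ^ (1 + δ) * S ^ (ε + (1 + δ))) := by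
        rw [Real.mul_rpow hA hS.le, Real.mul_rpow hn (by positivity), Real.mul_rpow hσ.le hS.le,
          Real.rpow_add hS ε]
        ring
    _ ≤ _ := by gcongr

lemma normStar_nonneg {N k : ℕ} {L : ℝ} {P : ℕ → Euc N} {x : Euc N} {μ τ : ℝ} {u : Euc N → ℝ}
    (hw : ∀ y ∈ strip N k L, 0 < wStar N L P x μ τ y) : 0 ≤ normStar N k L P x μ τ u := by
  refine Real.sSup_nonneg ?_
  rintro _ ⟨y, hy, rfl⟩
  exact div_nonneg (abs_nonneg _) (hw y hy).le

lemma abs_le_normStar_mul {N k : ℕ} {L : ℝ} {P : ℕ → Euc N} {x : Euc N} {μ τ : ℝ}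
    {u : Euc N → ℝ} (hu : FiniteStar N k L P x μ τ u)
    (hw : ∀ y ∈ strip N k L, 0 < wStar N L P x μ τ y) {y : Euc N} (hy : y ∈ strip N k L) :
    |u y| ≤ normStar N k L P x μ τ u * wStar N L P x μ τ y :=
  (div_le_iff₀ (hw y hy)).mp (le_csSup hu (Set.mem_image_of_mem _ hy))

lemma normStarStar_le {N k : ℕ} {L : ℝ} {P : ℕ → Euc N} {x : Euc N} {μ τ : ℝ} {f : Euc N → ℝ}
    {B : ℝ} (hB : 0 ≤ B) (hf : ∀ y ∈ strip N k L, 0 < wStarStar N L P x μ τ y ∧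
      |f y| ≤ B * wStarStar N L P x μ τ y) :
    normStarStar N k L P x μ τ f ≤ B := by
  refine Real.sSup_le ?_ hB
  rintro _ ⟨y, hy, rfl⟩
  exact (div_le_iff₀ (hf y hy).1).mpr (hf y hy).2

/-- Lemma 4.2, the higher order term `N(ω₁,ω₂)` is superlinear. -/
theorem lemma4_2
    (N k : ℕ) (hN : 5 ≤ N) (hk1 : 1 ≤ k) (hk2 : (k : ℝ) < ((N : ℝ) - 2) / 2)
    (K1 K2 : Euc N → ℝ) (a1 a2 β1 β2 : Fin N → ℝ) (βm1 βM1 σ1 βm2 βM2 σ2 : ℝ)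
    (hK1 : CondA N k K1 a1 β1 βm1 βM1 σ1) (hK2 : CondA N k K2 a2 β2 βm2 βM2 σ2)
    (s κ : ℝ) (hsκ : SyncConst N s κ)
    (P : ℕ → Euc N) (hP : LatticeEnum N k P)
    (τ : ℝ) (hτk : (k : ℝ) < τ) (hτN : τ < ((N : ℝ) - 2) / 2)
    (θ C0 : ℝ) (hθ : 0 < θ) (hC0 : 0 < C0) :
    ∃ δ C : ℝ, 0 < δ ∧ 0 < C ∧ ∀ (L : ℝ) (x : Euc N) (μ : ℝ),
      Admissible N θ C0 (min βm1 βm2) L x μ →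
      ∀ ω1 ω2 : Euc N → ℝ, MemX N k L P x μ τ ω1 ω2 →
        (∀ y : Euc N, |ω1 y| ≤ (1 / 2) * PU N k L P s κ x μ y) →
        (∀ y : Euc N, |ω2 y| ≤ (1 / 2) * PV N k L P s κ x μ y) →
        normStarStar N k L P x μ τ (Nl1 N k L P s κ K1 x μ ω1 ω2) +
            normStarStar N k L P x μ τ (Nl2 N k L P s κ K2 x μ ω1 ω2) ≤
          C * (normStar N k L P x μ τ ω1 + normStar N k L P x μ τ ω2) ^ (1 + δ) := by
  have hN5 : (5 : ℝ) ≤ N := by exact_mod_cast hN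
  have hp1 := one_lt_tS_sub_one hN
  set δ : ℝ := min 1 (tS N - 1 - 1) with hδ
  have hδ0 : 0 < δ := lt_min one_pos (by linarith)
  have hδ1 : δ ≤ 1 := min_le_left _ _
  have hδp : δ ≤ tS N - 1 - 1 := min_le_right _ _
  obtain ⟨hs, hκ, -, -⟩ := hsκ
  obtain ⟨cU, hcU, hPU⟩ :=
    exists_setIntegral_eq_mul_bubblePotential hN k P hs (mul_pos hκ hs)
  obtain ⟨cV, hcV, hPV⟩ :=
    exists_setIntegral_eq_mul_bubblePotential hN k P (mul_pos hκ hs) hs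
  obtain ⟨Cw, hCw, hw⟩ := exists_weight_bounds hN hk1 hP hτk hτN
  obtain ⟨M1, hM1⟩ := hK1.bounded
  obtain ⟨M2, hM2⟩ := hK2.bounded
  set c : ℝ := cU / cV + cV / cU with hc
  obtain ⟨C1, hC1, hR1⟩ := exists_abs_remainder_le_rpow hN M1 c hδ0 hδ1
  obtain ⟨C2, hC2, hR2⟩ := exists_abs_remainder_le_rpow hN M2 c hδ0 hδ1
  set ε : ℝ := tS N - 1 - 1 - δ with hε
  have hε0 : 0 ≤ ε := by linarith
  set G : ℝ := ((cU * Cw) ^ ε + (cV * Cw) ^ ε) * Cw with hG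
  have hG0 : 0 ≤ G := by positivity
  refine ⟨δ, (C1 + C2) * G + 1, hδ0, by positivity, ?_⟩
  rintro L x μ ⟨hμ1, hL1, hx, -⟩ ω1 ω2 ⟨-, -, hf1, hf2⟩ hω1 hω2
  have hμ0 : 0 < μ := by linarith
  have hx1 : ‖x‖ ≤ 1 := hx.trans (Real.rpow_le_one_of_one_le_of_nonpos hμ1 (by linarith))
  have hU : ∀ y, PU N k L P s κ x μ y = cU * bubblePotential N k L P x μ y :=
    fun y => hPU L x μ y hμ0
  have hV : ∀ y, PV N k L P s κ x μ y = cV * bubblePotential N k L P x μ y :=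
    fun y => hPV L x μ y hμ0
  have hU0 : ∀ y, 0 ≤ PU N k L P s κ x μ y := fun y => by
    have := (abs_nonneg _).trans (hω1 y); linarith
  have hV0 : ∀ y, 0 ≤ PV N k L P s κ x μ y := fun y => by
    have := (abs_nonneg _).trans (hω2 y); linarith
  have hUV : ∀ y, PU N k L P s κ x μ y ≤ c * PV N k L P s κ x μ y := fun y => by
    have h1 : PU N k L P s κ x μ y = cU / cV * PV N k L P s κ x μ y := by
      rw [hU, hV]; field_simp
    have h2 : 0 ≤ cV / cU * PV N k L P s κ x μ y := mul_nonneg (by positivity) (hV0 y)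
    rw [hc, add_mul]; linarith
  have hVU : ∀ y, PV N k L P s κ x μ y ≤ c * PU N k L P s κ x μ y := fun y => by
    have h1 : PV N k L P s κ x μ y = cV / cU * PU N k L P s κ x μ y := by
      rw [hU, hV]; field_simp
    have h2 : 0 ≤ cU / cV * PU N k L P s κ x μ y := mul_nonneg (by positivity) (hU0 y)
    rw [hc, add_mul]; linarith
  set n : ℝ := normStar N k L P x μ τ ω1 + normStar N k L P x μ τ ω2 with hn
  have hwp : ∀ y ∈ strip N k L, 0 < wStar N L P x μ τ y := fun y hy => by
    obtain ⟨S, σ, hS, hσ, -, h1, -⟩ := hw L μ x y hL1 hμ1 hx1 hy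
    rw [h1]; positivity
  have hn1 : 0 ≤ normStar N k L P x μ τ ω1 := normStar_nonneg hwp
  have hn2 : 0 ≤ normStar N k L P x μ τ ω2 := normStar_nonneg hwp
  have hn0 : 0 ≤ n := add_nonneg hn1 hn2
  have hsum : ∀ y ∈ strip N k L, 0 < wStarStar N L P x μ τ y ∧
      PU N k L P s κ x μ y ^ ε * |ω1 y| ^ (1 + δ) + PV N k L P s κ x μ y ^ ε * |ω2 y| ^ (1 + δ) ≤
        G * n ^ (1 + δ) * wStarStar N L P x μ τ y := by
    intro y hy
    obtain ⟨S, σ, hS, hσ, hσ1, hwS, hwSS, hpos, hΦ⟩ := hw L μ x y hL1 hμ1 hx1 hy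
    have hb1 : |ω1 y| ≤ n * (σ * S) := by
      rw [← hwS]
      exact (abs_le_normStar_mul hf1 hwp hy).trans
        (mul_le_mul_of_nonneg_right (by linarith) (hwp y hy).le)
    have hb2 : |ω2 y| ≤ n * (σ * S) := by
      rw [← hwS]
      exact (abs_le_normStar_mul hf2 hwp hy).trans
        (mul_le_mul_of_nonneg_right (by linarith) (hwp y hy).le)
    have hUS : PU N k L P s κ x μ y ≤ cU * Cw * S := by
      rw [hU, mul_assoc]
      exact mul_le_mul_of_nonneg_left ((le_abs_self _).trans hΦ) hcU.le
    have hVS : PV N k L P s κ x μ y ≤ cV * Cw * S := by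
      rw [hV, mul_assoc]
      exact mul_le_mul_of_nonneg_left ((le_abs_self _).trans hΦ) hcV.le
    have t1 := rpow_mul_rpow_le_weight (hU0 y) (by positivity) hε0 hδ0.le hS hσ hσ1 hn0 hUS hb1
    have t2 := rpow_mul_rpow_le_weight (hV0 y) (by positivity) hε0 hδ0.le hS hσ hσ1 hn0 hVS hb2
    have hexp : ε + (1 + δ) = tS N - 1 := by rw [hε]; ring
    rw [hexp] at t1 t2
    refine ⟨hpos, (add_le_add t1 t2).trans ?_⟩
    calc _ = ((cU * Cw) ^ ε + (cV * Cw) ^ ε) * n ^ (1 + δ) * (σ * S ^ (tS N - 1)) := by ring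
      _ ≤ ((cU * Cw) ^ ε + (cV * Cw) ^ ε) * n ^ (1 + δ) * (Cw * wStarStar N L P x μ τ y) := by
          gcongr
      _ = _ := by rw [hG]; ring
  have hfirst : normStarStar N k L P x μ τ (Nl1 N k L P s κ K1 x μ ω1 ω2) ≤
      C1 * G * n ^ (1 + δ) := by
    refine normStarStar_le (by positivity) fun y hy => ⟨(hsum y hy).1, ?_⟩
    have h := hR1 (K1 y) _ _ (ω1 y) (ω2 y) (hM1 y) (hU0 y) (hV0 y) (hUV y) (hVU y) (hω1 y) (hω2 y)
    calc |Nl1 N k L P s κ K1 x μ ω1 ω2 y| ≤ _ := h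
      _ ≤ C1 * (G * n ^ (1 + δ) * wStarStar N L P x μ τ y) :=
          mul_le_mul_of_nonneg_left (hsum y hy).2 hC1
      _ = _ := by ring
  have hsecond : normStarStar N k L P x μ τ (Nl2 N k L P s κ K2 x μ ω1 ω2) ≤
      C2 * G * n ^ (1 + δ) := by
    refine normStarStar_le (by positivity) fun y hy => ⟨(hsum y hy).1, ?_⟩
    have h := hR2 (K2 y) _ _ (ω2 y) (ω1 y) (hM2 y) (hV0 y) (hU0 y) (hVU y) (hUV y) (hω2 y) (hω1 y)
    calc |Nl2 N k L P s κ K2 x μ ω1 ω2 y| ≤ _ := h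
      _ ≤ C2 * (G * n ^ (1 + δ) * wStarStar N L P x μ τ y) :=
          mul_le_mul_of_nonneg_left ((add_comm _ _).trans_le (hsum y hy).2) hC2
      _ = _ := by ring
  have hnn : 0 ≤ n ^ (1 + δ) := by positivity
  calc _ ≤ C1 * G * n ^ (1 + δ) + C2 * G * n ^ (1 + δ) := add_le_add hfirst hsecond
    _ ≤ ((C1 + C2) * G + 1) * n ^ (1 + δ) := by nlinarith

end PeriodicCriticalSystem
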